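/- arXiv:2507.10882 — 3 statements merged into one kernel-verified Lean document; each statement's English description precedes it below -/
import Mathlib

section
/- Let G be a finite group and let x ∈ G be a p-element for some prime p. Assume there exist two distinct primes r and s such that for every g ∈ G, either [x,g] = 1 or the order of [x,g] is divisible by rs. Then x ∈ Z(G). -/
section FrobAux
open Representation
set_option linter.unusedSectionVars false
universe u
variable {k : Type} [Field k] [IsAlgClosed k] [CharZero k]
def IrrC (k : Type) [Field k] (G : Type u) [Group G] : Set (G → k) :=
  {χ | ∃ (V : Type u) (_ : AddCommGroup V) (_ : Module k V) (_ : FiniteDimensional k V)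
    (ρ : Representation k G V), ρ.IsIrreducible ∧ χ = ρ.character}

noncomputable def ip {k : Type} [Field k] {G : Type u} [Group G] [Fintype G] (f g : G → k) : k :=
  (Nat.card G : k)⁻¹ * ∑ a : G, f a * g a⁻¹

theorem irr_scalar_zero {G : Type u} [Group G] [Fintype G] (f : G → k)
    (hf : ∀ a b, f (a * b) = f (b * a)) (V : Type u) [AddCommGroup V] [Module k V]
    [FiniteDimensional k V] (ρ : Representation k G V) [ρ.IsIrreducible]
    (h : ∑ g, f g * ρ.character g = 0) : ∑ g, f g • ρ g = 0 := by
  let T : IntertwiningMap ρ ρ := ⟨∑ g, f g • ρ g, by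
    intro b
    ext v
    simp only [LinearMap.comp_apply, LinearMap.sum_apply, LinearMap.smul_apply, map_sum, map_smul]
    simp only [← Module.End.mul_apply, ← map_mul]
    refine Fintype.sum_equiv (MulAut.conj b⁻¹).toEquiv _ _ ?_
    intro g
    have : f (b⁻¹ * (g * b)) = f g := by rw [hf, mul_assoc, mul_inv_cancel, mul_one]
    simp [this, mul_assoc]⟩
  obtain ⟨c, hc⟩ := (IsIrreducible.algebraMap_intertwiningMap_bijective_of_isAlgClosed (k := k) (ρ := ρ)).2 T
  have hT : ∑ g, f g • ρ g = c • LinearMap.id := by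
    have := congrArg IntertwiningMap.toLinearMap hc
    rw [show T.toLinearMap = ∑ g, f g • ρ g from rfl] at this
    rw [← this]; ext v; simp [Algebra.algebraMap_eq_smul_one]
  have ht : LinearMap.trace k V (∑ g, f g • ρ g) = 0 := by
    simpa [character] using h
  rw [hT] at ht
  have : Nontrivial V := by
    by_contra hn
    rw [not_nontrivial_iff_subsingleton] at hn
    have h1 : (⊥ : Subrepresentation ρ) ≠ ⊤ := bot_ne_top
    apply h1
    ext v
    simp [Subsingleton.elim v 0]
  simp at ht
  rcases ht with h0 | h0
  · rw [hT, h0, zero_smul]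
  · exact absurd h0 Module.finrank_pos.ne'

theorem simple_smul_zero {G : Type u} [Group G] [Fintype G] (f : G → k)
    (hf : ∀ a b, f (a * b) = f (b * a)) (h : ∀ χ ∈ IrrC k G, ∑ g, f g * χ g = 0)
    (M : Type u) [AddCommGroup M] [Module k M] [Module (MonoidAlgebra k G) M]
    [IsScalarTower k (MonoidAlgebra k G) M]
    (hm : IsSimpleModule (MonoidAlgebra k G) M) (v : M) :
    (∑ g, MonoidAlgebra.single g (f g) : MonoidAlgebra k G) • v = 0 := by
  have hfd : FiniteDimensional k M := Module.Finite.trans (MonoidAlgebra k G) _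
  let ρ : Representation k G M := ofModule' M
  have hρ : ∀ (r : MonoidAlgebra k G) (v : M), ρ.asAlgebraHom r v = r • v := by
    intro r v
    simp [ρ, ofModule', asAlgebraHom]
  have hirr : ρ.IsIrreducible := by
    rw [irreducible_iff_isSimpleModule_asModule]
    let e : ρ.asModule ≃ₗ[MonoidAlgebra k G] M :=
      { ρ.asModuleEquiv with
        map_smul' := by
          intro r v
          exact (ρ.asModuleEquiv_map_smul r v).trans (hρ r _) }
    exact IsSimpleModule.congr e
  have := irr_scalar_zero f hf M ρ (h _ ⟨_, _, _, hfd, ρ, hirr, rfl⟩)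
  have h2 : ρ.asAlgebraHom (∑ g, MonoidAlgebra.single g (f g) : MonoidAlgebra k G) = 0 := by
    rw [← this]; simp [asAlgebraHom_single]
  rw [← hρ, h2]; rfl

theorem complete {G : Type u} [Group G] [Fintype G] (f : G → k)
    (hf : ∀ a b, f (a * b) = f (b * a)) (h : ∀ χ ∈ IrrC k G, ∑ g, f g * χ g = 0) : f = 0 := by
  classical
  have top := IsSemisimpleModule.sSup_simples_eq_top (MonoidAlgebra k G) (MonoidAlgebra k G)
  have key : ∀ y ∈ sSup {m : Submodule (MonoidAlgebra k G) (MonoidAlgebra k G) |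
      IsSimpleModule (MonoidAlgebra k G) m},
      (∑ g, MonoidAlgebra.single g (f g) : MonoidAlgebra k G) * y = 0 := by
    intro y hy
    rw [sSup_eq_iSup'] at hy
    induction hy using Submodule.iSup_induction' with
    | mem i x hx =>
      exact congrArg Subtype.val (simple_smul_zero f hf h i.1 i.2 ⟨x, hx⟩)
    | zero => simp
    | add x y _ _ h1 h2 => rw [mul_add, h1, h2, add_zero]
  have ha := key 1 (by rw [top]; trivial)
  rw [mul_one] at ha
  funext g
  have := congrArg (fun b : MonoidAlgebra k G => b.coeff g) ha
  simpa [Finsupp.single_apply] using this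


section ipsec
variable {G : Type u} [Group G] [Fintype G]

theorem ip_comm (f g : G → k) : ip f g = ip g f := by
  unfold ip
  congr 1
  refine Fintype.sum_equiv (Equiv.inv G) _ _ ?_
  intro a; simp [mul_comm]

theorem ip_sum_left {ι : Type*} (s : Finset ι) (c : ι → k) (F : ι → G → k) (g : G → k) :
    ip (∑ i ∈ s, c i • F i) g = ∑ i ∈ s, c i * ip (F i) g := by
  unfold ip
  simp only [Finset.sum_apply, Pi.smul_apply, smul_eq_mul, Finset.sum_mul, Finset.mul_sum]
  rw [Finset.sum_comm]
  refine Finset.sum_congr rfl fun i _ => Finset.sum_congr rfl fun a _ => ?_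
  ring

theorem ip_sub_left (f f' g : G → k) : ip (f - f') g = ip f g - ip f' g := by
  simp [ip, sub_mul, mul_sub, Finset.sum_sub_distrib]

theorem ip_add_left (f f' g : G → k) : ip (f + f') g = ip f g + ip f' g := by
  simp [ip, add_mul, mul_add, Finset.sum_add_distrib]

theorem ip_smul_left (c : k) (f g : G → k) : ip (c • f) g = c * ip f g := by
  simp [ip, Finset.mul_sum]; refine Finset.sum_congr rfl fun i _ => by ring

noncomputable def invcard : Invertible (Nat.card G : k) :=
  invertibleOfNonzero (by exact_mod_cast Nat.card_pos.ne')

theorem ip_char_nat {V W : Type*} [AddCommGroup V] [Module k V] [FiniteDimensional k V]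
    [AddCommGroup W] [Module k W] [FiniteDimensional k W]
    (ρ : Representation k G V) (σ : Representation k G W) :
    ∃ n : ℕ, ip σ.character ρ.character = n := by
  let _ : Invertible (Nat.card G : k) := invcard
  exact ⟨_, card_inv_mul_sum_char_mul_char_eq_finrank ρ σ⟩

open scoped Classical in
theorem irr_orth {χ ψ : G → k} (h1 : χ ∈ IrrC k G) (h2 : ψ ∈ IrrC k G) :
    ip χ ψ = if χ = ψ then 1 else 0 := by
  let _ : Invertible (Nat.card G : k) := invcard
  obtain ⟨V, _, _, _, ρ, hρ, rfl⟩ := h1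
  obtain ⟨W, _, _, _, σ, hσ, rfl⟩ := h2
  split_ifs with h
  · unfold ip
    have hn : Nonempty (ρ.Equiv ρ) := ⟨Representation.Equiv.refl ρ⟩
    rw [← h, char_orthonormal, if_pos hn]
  · unfold ip
    have hn : ¬ Nonempty (σ.Equiv ρ) := by
      rintro ⟨e⟩
      exact h (char_iso e).symm
    rw [char_orthonormal, if_neg hn]

theorem irr_class {χ : G → k} (h1 : χ ∈ IrrC k G) (a b : G) : χ (a * b) = χ (b * a) := by
  obtain ⟨V, _, _, _, ρ, hρ, rfl⟩ := h1
  exact char_mul_comm _ _ _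

theorem irr_finite : (IrrC k G).Finite := by
  classical
  have : LinearIndependent k (fun χ : IrrC k G => (χ : G → k)) := by
    rw [linearIndependent_iff']
    intro s c hc i hi
    have h1 := ip_sum_left s c (fun χ : IrrC k G => (χ : G → k)) i
    rw [hc] at h1
    have h0 : ip (0 : G → k) i = 0 := by simp [ip]
    rw [h0] at h1
    simp only [irr_orth (Subtype.coe_prop _) (Subtype.coe_prop i), mul_ite, mul_one, mul_zero,
      SetCoe.ext_iff] at h1
    rw [Finset.sum_ite_eq' s i] at h1
    simpa [hi] using h1.symm
  exact this.setFinite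

theorem complete' (f : G → k) (hf : ∀ a b, f (a * b) = f (b * a))
    (h : ∀ χ ∈ IrrC k G, ip f χ = 0) : f = 0 := by
  have : (fun a => f a⁻¹) = 0 := by
    refine complete _ (fun a b => by simp [hf]) ?_
    intro χ hχ
    have := h χ hχ
    unfold ip at this
    have hc : (Nat.card G : k)⁻¹ ≠ 0 := inv_ne_zero (by exact_mod_cast Nat.card_pos.ne')
    rw [mul_eq_zero] at this
    rw [← this.resolve_left hc]
    refine Fintype.sum_equiv (Equiv.inv G) _ _ ?_
    intro a; simp
  funext a
  simpa using congrFun this a⁻¹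

theorem decomp (f : G → k) (hf : ∀ a b, f (a * b) = f (b * a)) :
    f = ∑ χ ∈ (irr_finite (k := k) (G := G)).toFinset, ip f χ • χ := by
  classical
  rw [← sub_eq_zero]
  refine complete' _ ?_ ?_
  · intro a b
    simp only [Pi.sub_apply, Finset.sum_apply, Pi.smul_apply, hf a b]
    congr 1
    refine Finset.sum_congr rfl fun χ hχ => ?_
    rw [irr_class (χ := χ) (by simpa using hχ) a b]
  · intro ψ hψ
    rw [ip_sub_left, ip_sum_left _ (fun χ => ip f χ) (fun χ => χ), sub_eq_zero,
      Finset.sum_eq_single ψ]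
    · rw [irr_orth hψ hψ]; simp
    · intro χ hχ hne
      rw [irr_orth (by simpa using hχ) hψ, if_neg hne, mul_zero]
    · intro hn; simp [hψ] at hn

theorem norm_one (f : G → k) (hf : ∀ a b, f (a * b) = f (b * a))
    (hi : ∀ χ ∈ IrrC k G, ∃ n : ℤ, ip f χ = n) (h1 : ip f f = 1) :
    ∃ χ ∈ IrrC k G, f = χ ∨ f = -χ := by
  classical
  have hd := decomp f hf
  set S := (irr_finite (k := k) (G := G)).toFinset with hS
  have hi' : ∀ χ : G → k, ∃ n : ℤ, χ ∈ IrrC k G → ip f χ = n := by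
    intro χ
    by_cases h : χ ∈ IrrC k G
    · obtain ⟨n, hn⟩ := hi χ h; exact ⟨n, fun _ => hn⟩
    · exact ⟨0, fun h' => absurd h' h⟩
  choose n hn using hi'
  have hmem : ∀ χ ∈ S, χ ∈ IrrC k G := fun χ hχ => by simpa [hS] using hχ
  have hsq : ∑ χ ∈ S, n χ * n χ = 1 := by
    have h2 := h1
    conv at h2 => lhs; arg 1; rw [hd]
    rw [ip_sum_left _ (fun χ => ip f χ) (fun χ => χ)] at h2
    have : ((∑ χ ∈ S, n χ * n χ : ℤ) : k) = 1 := by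
      rw [← h2]; push_cast
      refine Finset.sum_congr rfl fun χ hχ => ?_
      rw [ip_comm χ f, hn χ (hmem χ hχ)]
    exact_mod_cast this
  obtain ⟨χ, hχ, hne⟩ : ∃ χ ∈ S, n χ ≠ 0 := by
    by_contra! hcon
    rw [Finset.sum_eq_zero (fun χ hχ => by rw [hcon χ hχ]; rfl)] at hsq
    exact absurd hsq (by norm_num)
  rw [← Finset.add_sum_erase _ _ hχ] at hsq
  have hnn : ∀ ψ ∈ S.erase χ, 0 ≤ n ψ * n ψ := fun ψ _ => mul_self_nonneg _
  have hge : 0 ≤ ∑ ψ ∈ S.erase χ, n ψ * n ψ := Finset.sum_nonneg hnn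
  have hpos : 0 < n χ * n χ := mul_self_pos.2 hne
  have e0 : ∑ ψ ∈ S.erase χ, n ψ * n ψ = 0 := by omega
  have e1 : n χ * n χ = 1 := by omega
  rw [Finset.sum_eq_zero_iff_of_nonneg hnn] at e0
  have hf2 : f = (n χ : k) • χ := by
    rw [hd, Finset.sum_eq_single χ]
    · rw [hn χ (hmem χ hχ)]
    · intro ψ hψ hne
      have := e0 ψ (Finset.mem_erase.2 ⟨hne, hψ⟩)
      rw [hn ψ (hmem ψ hψ), mul_self_eq_zero.1 this]; simp
    · intro h; exact absurd hχ h
  refine ⟨χ, hmem χ hχ, ?_⟩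
  rcases mul_self_eq_one_iff.1 e1 with h | h
  · left; rw [hf2, h]; simp
  · right; rw [hf2, h]; simp

theorem exists_sep {h : G} (hh : h ≠ 1) : ∃ χ ∈ IrrC k G, χ h ≠ χ 1 := by
  classical
  by_contra! hcon
  have hd := decomp (fun g : G => if g = 1 then (1 : k) else 0) (by
    intro a b
    have : a * b = 1 ↔ b * a = 1 := mul_eq_one_comm
    simp [this])
  have e1 := congrFun hd 1
  have e2 := congrFun hd h
  simp only [Finset.sum_apply, Pi.smul_apply] at e1 e2
  rw [Finset.sum_congr rfl (fun χ hχ => by rw [hcon χ (by simpa using hχ)])] at e2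
  rw [← e1] at e2
  simp [hh] at e2
end ipsec


theorem one_mem_irr {G : Type u} [Group G] [Fintype G] : (fun _ => 1 : G → k) ∈ IrrC k G := by
  refine ⟨ULift.{u} k, inferInstance, inferInstance, inferInstance, 1, ?_, ?_⟩
  · have hs : IsSimpleModule k (ULift.{u} k) := IsSimpleModule.congr ULift.moduleEquiv
    refine { exists_pair_ne := ⟨⊥, ⊤, ?_⟩, eq_bot_or_eq_top := ?_ }
    · intro h
      have h2 := congrArg Subrepresentation.toSubmodule h
      exact absurd h2 (bot_ne_top (α := Submodule k (ULift.{u} k)))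
    · intro a
      rcases eq_bot_or_eq_top a.toSubmodule with h | h
      · left; exact Subrepresentation.toSubmodule_injective h
      · right; exact Subrepresentation.toSubmodule_injective h
  · funext g
    have : Module.finrank k (ULift.{u} k) = 1 := by
      rw [LinearEquiv.finrank_eq ULift.moduleEquiv]; simp
    simp [character, this]

theorem frob_step (k : Type) [Field k] [IsAlgClosed k] [CharZero k]
    {G : Type u} [Group G] [Fintype G] (H : Subgroup G)
    (hmal : ∀ g, g ∉ H → ∀ h ∈ H, g⁻¹ * h * g ∈ H → h = 1) (h0 : G) (hh0 : h0 ∈ H) (h01 : h0 ≠ 1) :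
    ∃ N : Subgroup G, N.Normal ∧ h0 ∉ N ∧ ∀ g, (∀ t, t⁻¹ * g * t ∉ H) → g ∈ N := by
  classical
  obtain ⟨l, hl, hsep⟩ := exists_sep (k := k) (G := H) (h := ⟨h0, hh0⟩)
    (fun h => h01 (congrArg Subtype.val h))
  set d := l 1 with hd
  have hcG : (Nat.card G : k) ≠ 0 := by exact_mod_cast Nat.card_pos.ne'
  have hcH : (Nat.card H : k) ≠ 0 := by exact_mod_cast Nat.card_pos.ne'
  let φ : G → k := fun g => if hg : g ∈ H then l ⟨g, hg⟩ - d else 0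
  let F : G → k := fun g => d + (Nat.card H : k)⁻¹ * ∑ t, φ (t⁻¹ * g * t)
  have hFconj : ∀ s g, F (s⁻¹ * g * s) = F g := by
    intro s g
    simp only [F]
    congr 2
    refine Fintype.sum_equiv (Equiv.mulLeft s) _ _ ?_
    intro t; simp [mul_assoc]
  have hFc : ∀ a b, F (a * b) = F (b * a) := by
    intro a b
    rw [← hFconj b (b * a)]; simp [mul_assoc]
  have hlconj : ∀ s g : H, l (s⁻¹ * g * s) = l g := by
    intro s g
    rw [irr_class hl]; simp [mul_assoc]
  have hFH : ∀ h : H, F h = l h := by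
    intro h
    by_cases h1 : h = 1
    · subst h1
      have : φ 1 = 0 := by simp only [φ, H.one_mem, dif_pos]; exact sub_self _
      simp [F, this, hd]
    · have : ∀ t : G, φ (t⁻¹ * h * t) = if t ∈ H then l h - d else 0 := by
        intro t
        split_ifs with ht
        · have hm : t⁻¹ * h * t ∈ H := H.mul_mem (H.mul_mem (H.inv_mem ht) h.2) ht
          simp only [φ, hm, dif_pos]
          rw [← hlconj ⟨t, ht⟩ h]; rfl
        · have hm : t⁻¹ * h * t ∉ H := fun hm => h1 (Subtype.ext (hmal t ht h h.2 hm))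
          simp only [φ, hm, dif_neg, not_false_eq_true]
      simp only [F, this]
      rw [← Finset.sum_filter, Finset.sum_const, nsmul_eq_mul]
      have hcard : (Finset.univ.filter (fun t => t ∈ H)).card = Nat.card H := by
        rw [Nat.card_eq_fintype_card, Fintype.card_subtype]
      rw [hcard, inv_mul_cancel_left₀ hcH]; ring
  have hFD : ∀ g, (∀ t, t⁻¹ * g * t ∉ H) → F g = d := by
    intro g hg
    have : ∀ t, φ (t⁻¹ * g * t) = 0 := fun t => by simp only [φ, hg t, dif_neg, not_false_eq_true]
    simp [F, this]
  have hrec : ∀ ψ : G → k, (∀ a b, ψ (a * b) = ψ (b * a)) →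
      ip F ψ = d * ip (fun _ => 1) ψ + (ip l (fun h : H => ψ h) -
        d * ip (fun _ => 1) (fun h : H => ψ h)) := by
    intro ψ hψ
    have e1 : ∑ g, (∑ t, φ (t⁻¹ * g * t)) * ψ g⁻¹
        = Nat.card G * ∑ h : H, (l h - d) * ψ (h⁻¹ : H) := by
      simp only [Finset.sum_mul]
      rw [Finset.sum_comm]
      have : ∀ t, ∑ g, φ (t⁻¹ * g * t) * ψ g⁻¹ = ∑ h : H, (l h - d) * ψ (h⁻¹ : H) := by
        intro t
        have e2 : ∑ g, φ (t⁻¹ * g * t) * ψ g⁻¹ = ∑ g, φ g * ψ g⁻¹ := by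
          refine Fintype.sum_equiv (MulAut.conj t⁻¹).toEquiv _ _ ?_
          intro g
          have : ψ (t⁻¹ * (g⁻¹ * t)) = ψ g⁻¹ := by rw [hψ]; simp [mul_assoc]
          simp [mul_assoc, this]
        rw [e2]
        have e3 : ∑ g, φ g * ψ g⁻¹ = ∑ g ∈ Finset.univ.filter (fun g => g ∈ H), φ g * ψ g⁻¹ := by
          rw [Finset.sum_filter]
          refine Finset.sum_congr rfl fun g _ => ?_
          split_ifs with hg
          · rfl
          · simp [φ, hg]
        rw [e3, Finset.sum_subtype (p := fun g => g ∈ H) _ (by simp)]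
        refine Finset.sum_congr rfl fun h _ => ?_
        simp [φ]
      simp only [this, Finset.sum_const, nsmul_eq_mul, Finset.card_univ, Nat.card_eq_fintype_card]
    have e4 : ∑ g, F g * ψ g⁻¹ = d * ∑ g, ψ g⁻¹ + (Nat.card H : k)⁻¹ *
        (Nat.card G * ∑ h : H, (l h - d) * ψ (h⁻¹ : H)) := by
      rw [← e1, Finset.mul_sum, Finset.mul_sum, ← Finset.sum_add_distrib]
      refine Finset.sum_congr rfl fun g _ => ?_
      simp only [F]; ring
    unfold ip
    rw [e4]
    simp only [sub_mul, Finset.sum_sub_distrib, ← Finset.mul_sum, one_mul]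
    field_simp
  have hl1 : ip l (fun _ => 1) = 0 := by
    rw [irr_orth hl one_mem_irr, if_neg]
    intro h
    apply hsep
    rw [hd, h]
  have h11 : ∀ (K : Type u) [Group K] [Fintype K], ip (fun _ => 1 : K → k) (fun _ => 1) = 1 := by
    intro K _ _
    rw [irr_orth one_mem_irr one_mem_irr, if_pos rfl]
  have hF1 : ip F (fun _ => 1) = 0 := by
    rw [hrec _ (fun _ _ => rfl), hl1, h11, h11]; ring
  have hFF : ip F F = 1 := by
    rw [hrec _ hFc, ip_comm _ F, hF1, show (fun h : H => F h) = l from funext hFH,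
      irr_orth hl hl, if_pos rfl, ip_comm _ l, hl1]; ring
  have hint : ∀ χ ∈ IrrC k G, ∃ n : ℤ, ip F χ = n := by
    intro χ hχ
    rw [hrec _ (irr_class hχ)]
    obtain ⟨n1, hn1⟩ : ∃ n : ℕ, ip (fun _ => 1) χ = n := by
      obtain ⟨V, _, _, _, ρ, hρ, rfl⟩ := hχ
      obtain ⟨W, _, _, _, σ, hσ, hh⟩ := one_mem_irr (k := k) (G := G)
      rw [hh]; exact ip_char_nat _ _
    obtain ⟨n2, hn2⟩ : ∃ n : ℕ, ip (fun _ => 1) (fun h : H => χ h) = n := by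
      obtain ⟨V, _, _, _, ρ, hρ, rfl⟩ := hχ
      obtain ⟨W, _, _, _, σ, hσ, hh⟩ := one_mem_irr (k := k) (G := H)
      rw [hh]
      exact ip_char_nat (ρ.comp H.subtype : Representation k H V) _
    obtain ⟨n3, hn3⟩ : ∃ n : ℕ, ip l (fun h : H => χ h) = n := by
      obtain ⟨V, _, _, _, ρ, hρ, rfl⟩ := hχ
      obtain ⟨W, _, _, _, σ, hσ, rfl⟩ := hl
      exact ip_char_nat (ρ.comp H.subtype : Representation k H V) _
    obtain ⟨n4, hn4⟩ : ∃ n : ℕ, d = n := by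
      obtain ⟨W, _, _, _, σ, hσ, rfl⟩ := hl
      exact ⟨_, char_one σ⟩
    refine ⟨n4 * n1 + (n3 - n4 * n2), ?_⟩
    rw [hn1, hn2, hn3, hn4]; push_cast; ring
  obtain ⟨χ, hχ, hc⟩ := norm_one F hFc hint hFF
  have hF1' : F 1 = d := hFH 1
  have hF0 : F h0 = l ⟨h0, hh0⟩ := hFH ⟨h0, hh0⟩
  obtain ⟨V, _, _, _, ρ, hρ, rfl⟩ := hχ
  have hFρ : F = ρ.character := by
    rcases hc with hc | hc
    · exact hc
    · exfalso
      obtain ⟨W, _, _, _, σ, hσ, rfl⟩ := hl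
      have e := congrFun hc 1
      rw [hF1', hd, Pi.neg_apply, char_one, char_one] at e
      have e' : ((Module.finrank k W + Module.finrank k V : ℕ) : k) = 0 := by
        push_cast; rw [e]; ring
      have e2 : Module.finrank k W + Module.finrank k V = 0 := by exact_mod_cast e'
      have e3 : Module.finrank k W = 0 := by omega
      have : Subsingleton W := Module.finrank_zero_iff.1 e3
      exact hsep (congrArg (LinearMap.trace k W) (Subsingleton.elim _ _))
  have hdV : d = Module.finrank k V := by rw [← hF1', hFρ, char_one]
  refine ⟨MonoidHom.ker ρ, inferInstance, ?_, ?_⟩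
  · intro hm
    have hm' : ρ h0 = 1 := hm
    apply hsep
    rw [← hF0, ← hF1', hFρ]
    simp [character, hm']
  · intro g hg
    have hpow : ∀ c : Subgroup.zpowers g, ρ.character (c : G) = d := by
      rintro ⟨c, i, rfl⟩
      rw [← hFρ]
      simp only
      by_cases h1 : g ^ i = 1
      · rw [h1, hF1']
      · refine hFD _ fun t ht => h1 ?_
        have hc : (t⁻¹ * g * t) ^ i = t⁻¹ * g ^ i * t := by
          have := conj_zpow (i := i) (a := t⁻¹) (b := g)
          simpa using this
        have := hmal _ (hg t) _ ht (by
          rw [← hc]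
          rw [show (t⁻¹ * g * t)⁻¹ * (t⁻¹ * g * t) ^ i * (t⁻¹ * g * t) = (t⁻¹ * g * t) ^ i by
            rw [mul_assoc, ← zpow_add_one, ← zpow_neg_one, ← zpow_add]; congr 1; ring]
          rw [hc]; exact ht)
        have h2 : g ^ i = t * (t⁻¹ * g ^ i * t) * t⁻¹ := by group
        rw [h2, this]; simp
    let σ : Representation k (Subgroup.zpowers g) V := ρ.comp (Subgroup.zpowers g).subtype
    let _ : Invertible (Nat.card (Subgroup.zpowers g) : k) := invcard
    have hs := card_inv_mul_sum_char_eq_finrank σ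
    have hs2 : ∀ c, σ.character c = d := hpow
    simp only [hs2, Finset.sum_const, nsmul_eq_mul, Finset.card_univ] at hs
    have hcC : (Nat.card (Subgroup.zpowers g) : k) ≠ 0 := by exact_mod_cast Nat.card_pos.ne'
    rw [← Nat.card_eq_fintype_card, inv_mul_cancel_left₀ hcC, hdV] at hs
    have htop : σ.invariants = ⊤ := Submodule.eq_top_of_finrank_eq (by exact_mod_cast hs.symm)
    show ρ g = 1
    ext v
    have hv : v ∈ σ.invariants := by rw [htop]; trivial
    exact hv ⟨g, Subgroup.mem_zpowers g⟩


theorem frob_kernel {G : Type u} [Group G] [Finite G] (H : Subgroup G)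
    (hmal : ∀ g, g ∉ H → ∀ h ∈ H, g⁻¹ * h * g ∈ H → h = 1) :
    ∃ K : Subgroup G, K.Normal ∧ (∀ h ∈ H, h ∈ K → h = 1) ∧
      ∀ g, (∀ t, t⁻¹ * g * t ∉ H) → g ∈ K := by
  have := Fintype.ofFinite G
  have hs := fun h : {h : G // h ∈ H ∧ h ≠ 1} => frob_step ℂ H hmal h.1 h.2.1 h.2.2
  choose N hN h1 h2 using hs
  refine ⟨⨅ i, N i, Subgroup.normal_iInf_normal hN, ?_, ?_⟩
  · intro h hh hK
    by_contra hne
    exact h1 ⟨h, hh, hne⟩ (Subgroup.mem_iInf.1 hK _)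
  · intro g hg
    exact Subgroup.mem_iInf.2 fun i => h2 i g hg

theorem exists_derangement {G : Type u} [Group G] [Finite G] (H : Subgroup G) (hH : H ≠ ⊤) :
    ∃ g : G, ∀ t, t⁻¹ * g * t ∉ H := by
  classical
  have := Fintype.ofFinite G
  by_contra! hcon
  have hb := MulAction.sum_card_fixedBy_eq_card_orbits_mul_card_group G (G ⧸ H)
  have ho : Fintype.card (Quotient (MulAction.orbitRel G (G ⧸ H))) = 1 := by
    rw [Fintype.card_eq_one_iff_nonempty_unique]
    have : Subsingleton (Quotient (MulAction.orbitRel G (G ⧸ H))) :=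
      (MulAction.pretransitive_iff_subsingleton_quotient G (G ⧸ H)).1 inferInstance
    exact ⟨⟨⟨Quotient.mk _ ((1 : G) : G ⧸ H)⟩, fun _ => Subsingleton.elim _ _⟩⟩
  rw [ho, one_mul] at hb
  have hlt : ∑ a : G, 1 < ∑ a : G, Fintype.card (MulAction.fixedBy (G ⧸ H) a) := by
    refine Finset.sum_lt_sum ?_ ⟨1, Finset.mem_univ _, ?_⟩
    · intro g _
      obtain ⟨t, ht⟩ := hcon g
      refine Fintype.card_pos_iff.2 ⟨⟨(t : G ⧸ H), ?_⟩⟩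
      rw [MulAction.mem_fixedBy]
      show ((g * t : G) : G ⧸ H) = t
      rw [eq_comm, QuotientGroup.eq, ← mul_assoc]; exact ht
    · rw [Fintype.one_lt_card_iff]
      obtain ⟨y, hy⟩ : ∃ y, y ∉ H := by
        by_contra! hc
        exact hH (eq_top_iff.2 fun a _ => hc a)
      refine ⟨⟨((1 : G) : G ⧸ H), by simp [MulAction.mem_fixedBy]⟩,
        ⟨(y : G ⧸ H), by simp [MulAction.mem_fixedBy]⟩, ?_⟩
      intro h
      have h' := congrArg Subtype.val h
      simp only [QuotientGroup.eq, inv_one, one_mul] at h'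
      exact hy h'
  rw [hb] at hlt
  simp at hlt

open scoped Pointwise in
theorem main_aux (n : ℕ) : ∀ {G : Type u} [Group G] [Finite G] (_ : Nat.card G = n)
    (p : ℕ) (_ : p.Prime) (x : G) (_ : ∃ n : ℕ, orderOf x = p ^ n)
    (_ : ∀ g : G, ∀ q : ℕ, q.Prime → (∃ m : ℕ, orderOf (x⁻¹ * g⁻¹ * x * g) = q ^ m) →
      x⁻¹ * g⁻¹ * x * g = 1), ∀ g, x * g = g * x := by
  induction n using Nat.strong_induction_on with
  | _ n ih =>
  intro G _ _ hn p hp x hx hC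
  have hpf : Fact p.Prime := ⟨hp⟩
  have comm_of : ∀ g : G, x⁻¹ * g⁻¹ * x * g = 1 → x * g = g * x := by
    intro g h
    have : x * g = (g * x) * (x⁻¹ * g⁻¹ * x * g) := by group
    rw [this, h, mul_one]
  by_contra! hcon
  obtain ⟨g0, hg0⟩ := hcon
  have hsub : ∀ H : Subgroup G, H ≠ ⊤ → x ∈ H → ∀ h ∈ H, x * h = h * x := by
    intro H hH hxH h hh
    have hlt : Nat.card H < n := by
      rw [← hn]
      refine lt_of_le_of_ne (Subgroup.card_le_card_group H) fun h => hH ?_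
      exact (Subgroup.card_eq_iff_eq_top H).1 h
    have := ih _ hlt (G := H) rfl p hp ⟨x, hxH⟩ (by simpa using hx) (by
      intro g q hq hm
      have := hC g q hq (by simpa [← Subgroup.orderOf_coe] using hm)
      exact Subtype.ext this) ⟨h, hh⟩
    exact congrArg Subtype.val this
  have hxpow : ∃ a : ℕ, x ^ p ^ a = 1 := by
    obtain ⟨a, ha⟩ := hx; exact ⟨a, by rw [← ha]; exact pow_orderOf_eq_one x⟩
  set Z := Subgroup.center G with hZ
  set M := Subgroup.centralizer ({x} : Set G) with hM
  have memM : ∀ g, g ∈ M ↔ x * g = g * x := by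
    intro g; rw [hM, Subgroup.mem_centralizer_singleton_iff]; exact eq_comm
  have hZM : Z ≤ M := Subgroup.center_le_centralizer _
  have hMtop : M ≠ ⊤ := fun h => hg0 ((memM g0).1 (h ▸ Subgroup.mem_top _))
  have hxZ : x ∉ Z := fun h => hg0 ((Subgroup.mem_center_iff.1 h g0).symm)
  have hxM : x ∈ M := (memM x).2 rfl
  have hmal : ∀ g, g ∉ M → ∀ y ∈ M, g⁻¹ * y * g ∈ M → y ∈ Z := by
    intro g hg y hy hgy
    by_contra hyZ
    have hC1 : Subgroup.centralizer ({y} : Set G) ≠ ⊤ := by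
      intro h
      apply hyZ
      rw [hZ, Subgroup.mem_center_iff]
      intro a
      have : a ∈ Subgroup.centralizer ({y} : Set G) := h ▸ Subgroup.mem_top _
      exact Subgroup.mem_centralizer_singleton_iff.1 this
    have hxC : x ∈ Subgroup.centralizer ({y} : Set G) := by
      rw [Subgroup.mem_centralizer_singleton_iff]; exact (memM y).1 hy
    have hzC : g * x * g⁻¹ ∈ Subgroup.centralizer ({y} : Set G) := by
      rw [Subgroup.mem_centralizer_singleton_iff]
      have := (memM _).1 hgy
      calc g * x * g⁻¹ * y = g * (x * (g⁻¹ * y * g)) * g⁻¹ := by group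
        _ = g * ((g⁻¹ * y * g) * x) * g⁻¹ := by rw [this]
        _ = y * (g * x * g⁻¹) := by group
    have hc := hsub _ hC1 hxC _ hzC
    have hcc : Commute x⁻¹ (g * x * g⁻¹) := Commute.inv_left hc
    have h1 := hC g⁻¹ p hp (by
      obtain ⟨a, ha⟩ := hxpow
      have he : x⁻¹ * g⁻¹⁻¹ * x * g⁻¹ = x⁻¹ * (g * x * g⁻¹) := by group
      rw [he]
      have : (x⁻¹ * (g * x * g⁻¹)) ^ p ^ a = 1 := by
        rw [hcc.mul_pow, conj_pow, inv_pow, ha]; simp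
      obtain ⟨m, _, hm⟩ := (Nat.dvd_prime_pow hp).1 (orderOf_dvd_of_pow_eq_one this)
      exact ⟨m, hm⟩)
    have h2 := (memM _).2 (comm_of _ h1)
    exact hg (by simpa using M.inv_mem h2)
  -- pass to the quotient by the centre
  let π : G →* G ⧸ Z := QuotientGroup.mk' Z
  have hπ1 : ∀ g, π g = 1 ↔ g ∈ Z := fun g => QuotientGroup.eq_one_iff g
  have memMbar : ∀ g, π g ∈ M.map π ↔ g ∈ M := by
    intro g
    constructor
    · rintro ⟨m, hm, he⟩
      have h1 : m⁻¹ * g ∈ Z := by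
        rw [← hπ1, map_mul, map_inv, he, inv_mul_cancel]
      have := M.mul_mem hm (hZM h1)
      simpa using this
    · intro h; exact ⟨g, h, rfl⟩
  have hmalbar : ∀ g, g ∉ M.map π → ∀ h ∈ M.map π, g⁻¹ * h * g ∈ M.map π → h = 1 := by
    intro g hg h hh hgh
    obtain ⟨g, rfl⟩ := QuotientGroup.mk'_surjective Z g
    obtain ⟨h, rfl⟩ := QuotientGroup.mk'_surjective Z h
    change π g ∉ _ at hg
    change π h ∈ _ at hh
    change (π g)⁻¹ * π h * π g ∈ _ at hgh
    rw [memMbar] at hg hh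
    rw [← map_inv, ← map_mul, ← map_mul, memMbar] at hgh
    exact (hπ1 h).2 (hmal g hg h hh hgh)
  obtain ⟨Kb, hKbn, hKbM, hKbD⟩ := frob_kernel (M.map π) hmalbar
  -- p does not divide |Kb|
  have hpK : ¬ p ∣ Nat.card Kb := by
    let X := Subgroup.zpowers (ConjAct.toConjAct (π x))
    have hX : IsPGroup p X := by
      obtain ⟨a, ha⟩ := hxpow
      rintro ⟨_, i, rfl⟩
      refine ⟨a, Subtype.ext ?_⟩
      show (ConjAct.toConjAct (π x) ^ i) ^ p ^ a = 1
      rw [← zpow_natCast, ← zpow_mul, mul_comm, zpow_mul, zpow_natCast, ← map_pow,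
        ← map_pow, ha]
      simp
    have hmod := hX.card_modEq_card_fixedPoints Kb
    have hfix : Nat.card (MulAction.fixedPoints X Kb) = 1 := by
      rw [Nat.card_eq_one_iff_unique]
      refine ⟨⟨?_⟩, ⟨⟨1, fun c => smul_one c⟩⟩⟩
      suffices H : ∀ a : MulAction.fixedPoints X Kb, a.1 = 1 by
        intro a b; exact Subtype.ext ((H a).trans (H b).symm)
      rintro ⟨⟨a, ha⟩, hf⟩
      have h1 := hf ⟨_, Subgroup.mem_zpowers _⟩
      have h2 : π x * a * (π x)⁻¹ = a := congrArg Subtype.val h1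
      have h3 : a⁻¹ * π x * a = π x := by
        rw [mul_inv_eq_iff_eq_mul] at h2
        rw [mul_assoc, h2, inv_mul_cancel_left]
      have h4 : a ∈ M.map π := by
        by_contra hna
        have := hmalbar a hna (π x) ((memMbar x).2 hxM) (by rw [h3]; exact (memMbar x).2 hxM)
        exact hxZ ((hπ1 x).1 this)
      exact Subtype.ext (hKbM a h4 ha)
    intro hd
    rw [hfix] at hmod
    have := (Nat.ModEq.dvd_iff hmod (dvd_refl p)).1 hd
    exact hp.one_lt.ne' (Nat.dvd_one.1 this)
  let K := Kb.comap π
  have hKn : K.Normal := hKbn.comap π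
  have hKM : ∀ y ∈ K, y ∈ M → y ∈ Z := by
    intro y hy hyM
    exact (hπ1 y).1 (hKbM _ ((memMbar y).2 hyM) hy)
  have hidx : (Z.subgroupOf K).index = Nat.card Kb := by
    have h1 : π.ker.relIndex K = Nat.card (K.map π) := Subgroup.relIndex_ker _ π
    rw [QuotientGroup.ker_mk'] at h1
    rw [Subgroup.map_comap_eq_self_of_surjective (QuotientGroup.mk'_surjective Z)] at h1
    exact h1
  have hSyl : ∀ q : ℕ, q.Prime → ∃ Q : Sylow q K, (Q : Subgroup K) ≤ Z.subgroupOf K := by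
    intro q hq
    have : Fact q.Prime := ⟨hq⟩
    let X := Subgroup.zpowers (ConjAct.toConjAct x)
    have hX : IsPGroup p X := by
      obtain ⟨a, ha⟩ := hxpow
      rintro ⟨_, i, rfl⟩
      refine ⟨a, Subtype.ext ?_⟩
      show (ConjAct.toConjAct x ^ i) ^ p ^ a = 1
      rw [← zpow_natCast, ← zpow_mul, mul_comm, zpow_mul, zpow_natCast, ← map_pow, ha]
      simp
    have hnd : ¬ p ∣ Nat.card (Sylow q K) := by
      intro hd
      obtain ⟨Q⟩ : Nonempty (Sylow q K) := inferInstance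
      have h1 := Q.card_eq_index_normalizer ▸ hd
      have h2 : Z.subgroupOf K ≤ Subgroup.normalizer ((Q : Subgroup K) : Set K) := by
        intro z hz
        have hz' : ∀ a : K, z * a = a * z := by
          intro a
          exact Subtype.ext ((Subgroup.mem_center_iff.1 (Subgroup.mem_subgroupOf.1 hz) a).symm)
        rw [Subgroup.mem_normalizer_iff]
        intro a
        rw [hz' a, mul_inv_cancel_right]
      rw [← hidx] at hpK
      exact hpK (h1.trans (Subgroup.index_dvd_of_le h2))
    obtain ⟨Q, hQ⟩ := hX.nonempty_fixed_point_of_prime_not_dvd_card (Sylow q K) hnd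
    refine ⟨Q, ?_⟩
    intro y hy
    rw [Subgroup.mem_subgroupOf]
    refine hKM _ y.2 ((memM _).2 (comm_of _ ?_))
    have hfix := hQ ⟨_, Subgroup.inv_mem _ (Subgroup.mem_zpowers (ConjAct.toConjAct x))⟩
    have hmem : (⟨_, Subgroup.inv_mem _ (Subgroup.mem_zpowers (ConjAct.toConjAct x))⟩ : X) • y⁻¹
        ∈ (Q : Subgroup K) := by
      rw [← hfix]
      exact Subgroup.smul_mem_pointwise_smul _ _ _ (Q.inv_mem hy)
    have hm2 := Q.mul_mem hmem hy
    obtain ⟨m, hm⟩ := Q.isPGroup' ⟨_, hm2⟩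
    have he : ((((⟨_, Subgroup.inv_mem _ (Subgroup.mem_zpowers (ConjAct.toConjAct x))⟩ : X) • y⁻¹)
        * y : K) : G) = x⁻¹ * (y : G)⁻¹ * x * y := by
      show x⁻¹ * (y : G)⁻¹ * x⁻¹⁻¹ * y = _
      rw [inv_inv]
    refine hC y q hq ?_
    rw [← he]
    have hp1 := congrArg Subtype.val (congrArg Subtype.val hm)
    obtain ⟨j, _, hj⟩ := (Nat.dvd_prime_pow hq).1 (orderOf_dvd_of_pow_eq_one hp1)
    exact ⟨j, hj⟩
  have hK1 : (Z.subgroupOf K).index = 1 := by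
    rw [Nat.eq_one_iff_not_exists_prime_dvd]
    intro q hq hd
    have : Fact q.Prime := ⟨hq⟩
    obtain ⟨Q, hQ⟩ := hSyl q hq
    exact Q.not_dvd_index (hd.trans (Subgroup.index_dvd_of_le hQ))
  rw [Subgroup.index_eq_one, Subgroup.subgroupOf_eq_top] at hK1
  obtain ⟨d, hd⟩ := exists_derangement M hMtop
  have hdK : d ∈ K := by
    refine hKbD _ fun t => ?_
    obtain ⟨t, rfl⟩ := QuotientGroup.mk'_surjective Z t
    change (π t)⁻¹ * π d * π t ∉ _
    rw [← map_inv, ← map_mul, ← map_mul, memMbar]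
    exact hd t
  exact hd 1 (by simpa using hZM (hK1 hdK))

end FrobAux

/-- Theorem 1.4: Let `G` be a finite group and `x ∈ G` a `p`-element for some prime `p`.
If there exist two distinct primes `r` and `s` such that for every `g ∈ G` either
`[x,g] = 1` or `rs` divides the order of `[x,g]`, then `x ∈ Z(G)`. -/
theorem stmt3 {G : Type*} [Group G] [Finite G] (p : ℕ) (hp : p.Prime) (x : G)
    (hx : ∃ n : ℕ, orderOf x = p ^ n)
    (r s : ℕ) (hr : r.Prime) (hs : s.Prime) (hrs : r ≠ s)
    (h : ∀ g : G, x⁻¹ * g⁻¹ * x * g = 1 ∨ r * s ∣ orderOf (x⁻¹ * g⁻¹ * x * g)) :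
    x ∈ Subgroup.center G := by
  rw [Subgroup.mem_center_iff]
  intro g
  refine (main_aux _ rfl p hp x hx ?_ g).symm
  intro g q hq ⟨m, hm⟩
  refine (h g).resolve_right fun hd => hrs ?_
  rw [hm] at hd
  have h1 := (Nat.prime_dvd_prime_iff_eq hr hq).1 (hr.dvd_of_dvd_pow ((dvd_mul_right r s).trans hd))
  have h2 := (Nat.prime_dvd_prime_iff_eq hs hq).1 (hs.dvd_of_dvd_pow ((dvd_mul_left s r).trans hd))
  rw [h1, h2]
end

section
/- Let G be a finite group, x ∈ G, and suppose the conjugacy class size |x^G| is a power of a prime. Then the normal closure ⟨x^G⟩ is solvable. In particular, if G is a nonabelian simple group, then no nontrivial conjugacy class has prime power size. -/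
theorem idem_trace {R n : Type*} [CommRing R] [IsLocalRing R] [Fintype n] [DecidableEq n]
    (E F : Matrix n n R) (hE : E * E = E) (hF : F * F = F)
    (h : ∀ i j, IsLocalRing.residue R (E i j) = IsLocalRing.residue R (F i j)) :
    E.trace = F.trace := by
  set U : Matrix n n R := E * F + (1 - E) * (1 - F) with hU
  have hEF : E.map (IsLocalRing.residue R) = F.map (IsLocalRing.residue R) := by
    ext i j; simp [h]
  have hUm : (IsLocalRing.residue R).mapMatrix U = 1 := by
    have : (IsLocalRing.residue R).mapMatrix E = (IsLocalRing.residue R).mapMatrix F := hEF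
    rw [hU, map_add, map_mul, map_mul, map_sub, map_sub, this, ← map_sub, ← map_mul, ← map_mul,
      ← map_add]
    have : F * F + (1 - F) * (1 - F) = 1 := by
      rw [sub_mul, mul_sub, mul_sub, hF]; simp
    rw [this, map_one]
  have hdet : IsUnit U.det := by
    by_contra hc
    have : IsLocalRing.residue R U.det = 0 := by
      rwa [IsLocalRing.residue_eq_zero_iff, IsLocalRing.mem_maximalIdeal]
    rw [RingHom.map_det, hUm, Matrix.det_one] at this
    exact one_ne_zero this
  have h1 : E * U = U * F := by
    have e1 : E * (1 - E) = 0 := by rw [mul_sub, hE, mul_one, sub_self]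
    have e2 : (1 - F) * F = 0 := by rw [sub_mul, hF, one_mul, sub_self]
    rw [hU, mul_add, add_mul, ← mul_assoc, hE, ← mul_assoc, e1, mul_assoc, hF,
      mul_assoc, e2, zero_mul, mul_zero]
  have h2 : E = U * F * U⁻¹ := by
    rw [← h1, mul_assoc, Matrix.mul_nonsing_inv _ hdet, mul_one]
  rw [h2, Matrix.trace_mul_comm, ← mul_assoc, Matrix.nonsing_inv_mul _ hdet, one_mul]

theorem exists_val (r : ℕ) (hr : r.Prime) : ∃ O : ValuationSubring ℂ,
    (∀ z : ℂ, IsIntegral ℤ z → z ∈ O) ∧ CharP (IsLocalRing.ResidueField O) r := by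
  let A : Subring ℂ := (Int.castRingHom ℂ).range
  let I : Ideal A := Ideal.span {(r : A)}
  have hI : I ≠ ⊤ := by
    rw [Ne, Ideal.span_singleton_eq_top]
    rintro hu
    obtain ⟨⟨_, ⟨m, rfl⟩⟩, hm⟩ := hu.exists_right_inv
    have := congrArg Subtype.val hm
    simp only [Subring.coe_mul, Subring.coe_one] at this
    simp only [SubringClass.coe_natCast, eq_intCast] at this
    have h2 : (r : ℤ) * m = 1 := by exact_mod_cast this
    have := Int.isUnit_iff.1 (IsUnit.of_mul_eq_one _ h2)
    have := hr.two_le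
    omega
  obtain ⟨O, hO, hsub⟩ := Ideal.image_subset_nonunits_valuationSubring I hI
  refine ⟨O, ?_, ?_⟩
  · intro z hz
    have : IsIntegral O z := by
      obtain ⟨f, hf, hf2⟩ := hz
      refine ⟨f.map (Int.castRingHom O), hf.map _, ?_⟩
      rw [Polynomial.eval₂_map]
      rw [← hf2]
      congr 1
    obtain ⟨y, hy⟩ := IsIntegrallyClosed.isIntegral_iff.1 this
    rw [← hy]; exact y.2
  · have h0 : ((r : ℕ) : IsLocalRing.ResidueField O) = 0 := by
      rw [← map_natCast (IsLocalRing.residue O), IsLocalRing.residue_eq_zero_iff]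
      have : ((r : A) : ℂ) ∈ O.nonunits := hsub ⟨(r : A), Ideal.mem_span_singleton_self _, rfl⟩
      rw [ValuationSubring.mem_nonunits_iff_exists_mem_maximalIdeal] at this
      obtain ⟨ha, h⟩ := this
      have e : (⟨((r : A) : ℂ), ha⟩ : O) = (r : O) := by
        apply Subtype.ext; simp
      rwa [e] at h
    obtain ⟨q, hq⟩ := CharP.exists (IsLocalRing.ResidueField O)
    have hd : q ∣ r := (CharP.cast_eq_zero_iff _ q r).1 h0
    rcases (Nat.dvd_prime hr).1 hd with h | h
    · exact absurd h (CharP.char_ne_one (IsLocalRing.ResidueField O) q)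
    · rwa [h] at hq
theorem avg_unit {K : Type*} [Field K] [NumberField K] (s : Multiset K) (e : ℕ) (he : 0 < e)
    (hs : ∀ z ∈ s, z ^ e = 1) (hint : IsIntegral ℤ (s.sum / s.card)) (h0 : s.sum ≠ 0)
    (φ : K →+* ℂ) : ‖φ (s.sum / s.card)‖ = 1 := by
  have hc : s.card ≠ 0 := by
    rintro h; rw [Multiset.card_eq_zero] at h; simp [h] at h0
  have hle : ∀ ψ : K →+* ℂ, ‖ψ (s.sum / s.card)‖ ≤ 1 := by
    intro ψ
    rw [map_div₀, map_natCast, norm_div, Complex.norm_natCast, div_le_one (by positivity)]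
    rw [map_multiset_sum]
    refine (norm_multiset_sum_le _).trans ?_
    rw [Multiset.map_map]
    have : Multiset.map (norm ∘ ψ) s = Multiset.map (fun _ => (1:ℝ)) s := by
      apply Multiset.map_congr rfl
      intro z hz
      have : ψ z ^ e = 1 := by rw [← map_pow, hs z hz, map_one]
      exact Complex.norm_eq_one_of_pow_eq_one this he.ne'
    rw [this]; simp
  obtain ⟨n, hn, h⟩ := NumberField.Embeddings.pow_eq_one_of_norm_le_one K ℂ (x := s.sum / s.card)
    (div_ne_zero h0 (by exact_mod_cast hc)) hint hle
  have : φ (s.sum / s.card) ^ n = 1 := by rw [← map_pow, h, map_one]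
  exact Complex.norm_eq_one_of_pow_eq_one this (by omega)

theorem avg_unit' (s : Multiset ℂ) (e : ℕ) (he : 0 < e)
    (hs : ∀ z ∈ s, z ^ e = 1) (hint : IsIntegral ℤ (s.sum / s.card)) (h0 : s.sum ≠ 0) :
    ‖s.sum / s.card‖ = 1 := by
  classical
  let S : Set ℂ := {z | z ∈ s}
  have hfin : S.Finite := by
    have : S = (s.toFinset : Set ℂ) := by ext; simp [S]
    rw [this]; exact Finset.finite_toSet _
  let K := IntermediateField.adjoin ℚ S
  have : FiniteDimensional ℚ K := by
    have : Finite S := hfin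
    apply IntermediateField.finiteDimensional_adjoin
    intro z hz
    refine ⟨Polynomial.X ^ e - 1, Polynomial.monic_X_pow_sub_C 1 he.ne', ?_⟩
    simp [hs z hz]
  have : NumberField K := ⟨⟩
  let t : Multiset K := s.pmap (fun z hz => ⟨z, IntermediateField.subset_adjoin ℚ S hz⟩)
    (fun z hz => hz)
  have ht : t.map (algebraMap K ℂ) = s := by
    simp only [t, Multiset.map_pmap]
    exact (Multiset.pmap_eq_map _ _ _ _).trans (Multiset.map_id s)
  have hcard : t.card = s.card := by simp [t]
  have hsum : algebraMap K ℂ (t.sum / t.card) = s.sum / s.card := by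
    rw [map_div₀, map_natCast, map_multiset_sum, ht, hcard]
  rw [← hsum]
  refine avg_unit t e he ?_ ?_ ?_ (algebraMap K ℂ)
  · intro z hz
    apply (algebraMap K ℂ).injective
    rw [map_pow, map_one]
    apply hs
    rw [← ht]; exact Multiset.mem_map_of_mem _ hz
  · rw [← hsum] at hint
    exact (isIntegral_algHom_iff (IsScalarTower.toAlgHom ℤ K ℂ) (algebraMap K ℂ).injective).1 hint
  · intro h
    apply h0
    rw [← ht, ← map_multiset_sum, h, map_zero]

theorem all_eq (s : Multiset ℂ) (h1 : ∀ z ∈ s, ‖z‖ = 1) (h : ‖s.sum / s.card‖ = 1) :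
    ∀ z ∈ s, z = s.sum / s.card := by
  classical
  set α := s.sum / s.card with hα
  have hc : (s.card : ℂ) ≠ 0 := by
    intro h'; rw [h', div_zero] at hα; rw [hα] at h; simp at h
  have key : ∀ z ∈ s, ((starRingEnd ℂ α) * z).re ≤ 1 := by
    intro z hz
    refine (Complex.re_le_norm _).trans ?_
    rw [norm_mul, h1 z hz, RCLike.norm_conj, h, one_mul]
  have hsum : (s.map fun z => 1 - ((starRingEnd ℂ α) * z).re).sum = 0 := by
    rw [Multiset.sum_map_sub]
    have : (s.map fun z => ((starRingEnd ℂ α) * z).re).sum = ((starRingEnd ℂ α) * s.sum).re := by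
      have h5 := Multiset.sum_map_mul_left (s := s) (a := starRingEnd ℂ α) (f := fun z => z)
      rw [Multiset.map_id'] at h5
      rw [← h5]
      have := map_multiset_sum Complex.reAddGroupHom (s.map fun z => (starRingEnd ℂ α) * z)
      rw [Multiset.map_map] at this
      simpa using this.symm
    rw [this]
    have h2 : s.sum = α * s.card := by rw [hα]; field_simp
    rw [h2, ← mul_assoc, mul_comm (starRingEnd ℂ α), Complex.mul_conj, Complex.normSq_eq_norm_sq, h]
    simp
  intro z hz
  have hz0 : 1 - ((starRingEnd ℂ α) * z).re = 0 := by
    obtain ⟨t, rfl⟩ := Multiset.exists_cons_of_mem hz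
    rw [Multiset.map_cons, Multiset.sum_cons] at hsum
    have h3 : 0 ≤ (t.map fun z => 1 - ((starRingEnd ℂ α) * z).re).sum := by
      apply Multiset.sum_nonneg
      intro x hx
      obtain ⟨y, hy, rfl⟩ := Multiset.mem_map.1 hx
      have := key y (Multiset.mem_cons_of_mem hy)
      linarith
    have := key z hz
    linarith
  have e1 : z.re ^ 2 + z.im ^ 2 = 1 := by
    have := Complex.normSq_eq_norm_sq z
    rw [h1 z hz, Complex.normSq_apply] at this; nlinarith
  have e2 : α.re ^ 2 + α.im ^ 2 = 1 := by
    have := Complex.normSq_eq_norm_sq α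
    rw [h, Complex.normSq_apply] at this; nlinarith
  have e3 : α.re * z.re + α.im * z.im = 1 := by
    simp at hz0; linarith
  have e4 : (z.re - α.re) ^ 2 + (z.im - α.im) ^ 2 = 0 := by nlinarith
  apply Complex.ext
  · nlinarith [sq_nonneg (z.re - α.re), sq_nonneg (z.im - α.im)]
  · nlinarith [sq_nonneg (z.re - α.re), sq_nonneg (z.im - α.im)]

theorem scalar_of_integral {d : ℕ} (X : Matrix (Fin d) (Fin d) ℂ) (e : ℕ) (he : 0 < e)
    (hX : X ^ e = 1) (hint : IsIntegral ℤ (X.trace / d)) (h0 : X.trace ≠ 0) :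
    ∃ α : ℂ, X = algebraMap ℂ _ α := by
  classical
  have hsp : X.charpoly.Splits := IsAlgClosed.splits _
  set s := X.charpoly.roots with hs
  have hcard : s.card = d := by
    have := Polynomial.splits_iff_card_roots.1 hsp
    rw [hs, this, Matrix.charpoly_natDegree_eq_dim]; simp
  have hsum : X.trace = s.sum := Matrix.trace_eq_sum_roots_charpoly_of_splits hsp
  have hpow : ∀ z ∈ s, z ^ e = 1 := by
    intro z hz
    have h1 : z ∈ spectrum ℂ X := by
      rw [Matrix.mem_spectrum_iff_isRoot_charpoly]
      exact Polynomial.isRoot_of_mem_roots hz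
    have h2 := spectrum.pow_mem_pow X e h1
    rw [hX] at h2
    have : Nontrivial (Matrix (Fin d) (Fin d) ℂ) := by
      by_contra hn
      rw [not_nontrivial_iff_subsingleton] at hn
      rw [Subsingleton.elim X 0] at h0
      simp at h0
    rw [spectrum.one_eq] at h2
    exact h2
  have hall := all_eq s (fun z hz => Complex.norm_eq_one_of_pow_eq_one (hpow z hz) he.ne')
    (avg_unit' s e he hpow (by rw [← hsum, hcard]; exact hint) (by rwa [← hsum]))
  set α := s.sum / s.card
  refine ⟨α, ?_⟩
  have hrep : s = Multiset.replicate d α := by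
    rw [Multiset.eq_replicate]; exact ⟨hcard, hall⟩
  have hcp : X.charpoly = (Polynomial.X - Polynomial.C α) ^ d := by
    have := hsp.eq_prod_roots_of_monic X.charpoly_monic
    rw [← hs, hrep] at this
    simpa using this
  have hnil : IsNilpotent (X - algebraMap ℂ _ α) := by
    refine ⟨d, ?_⟩
    have := Matrix.aeval_self_charpoly X
    rw [hcp] at this
    simpa using this
  have hd1 : minpoly ℂ X ∣ Polynomial.X ^ e - 1 := minpoly.dvd _ _ (by simp [hX])
  have hsq : Squarefree (minpoly ℂ X) := by
    refine Squarefree.squarefree_of_dvd hd1 ?_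
    apply Polynomial.Separable.squarefree
    have := Polynomial.separable_X_pow_sub_C (F := ℂ) 1 (n := e) (by exact_mod_cast he.ne') one_ne_zero
    simpa using this
  have hd2 : minpoly ℂ X ∣ (Polynomial.X - Polynomial.C α) ^ d := minpoly.dvd _ _ (by
    rw [← hcp]; exact Matrix.aeval_self_charpoly X)
  have hd3 : minpoly ℂ X ∣ Polynomial.X - Polynomial.C α := by
    refine (hsq.dvd_pow_iff_dvd ?_).1 hd2
    rintro rfl
    apply h0
    simp
  have := Polynomial.aeval_eq_zero_of_dvd_aeval_eq_zero hd3 (minpoly.aeval ℂ X)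
  simpa [sub_eq_zero] using this

theorem trace_formula {G : Type*} [Group G] [Fintype G] {n : ℕ} {d : Fin n → ℕ}
    (Φ : MonoidAlgebra ℂ G ≃ₐ[ℂ] Π i, Matrix (Fin (d i)) (Fin (d i)) ℂ) (a : MonoidAlgebra ℂ G) :
    (Fintype.card G : ℂ) * a.coeff 1 = ∑ i, (d i : ℂ) * (Φ a i).trace := by
  classical
  have h1 : LinearMap.trace ℂ (MonoidAlgebra ℂ G) (LinearMap.mulLeft ℂ a)
      = (Fintype.card G : ℂ) * a.coeff 1 := by
    rw [LinearMap.trace_eq_matrix_trace ℂ (MonoidAlgebra.basis G ℂ), Matrix.trace]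
    have : ∀ g : G, (LinearMap.toMatrix (MonoidAlgebra.basis G ℂ) (MonoidAlgebra.basis G ℂ)
        (LinearMap.mulLeft ℂ a)) g g = a.coeff 1 := by
      intro g
      rw [LinearMap.toMatrix_apply]
      change (a * MonoidAlgebra.single g 1).coeff g = _
      rw [MonoidAlgebra.coeff_mul_single_eq_coeff_mul 1 (by simp), mul_one]
    simp [Matrix.diag, this]
  have h2 : LinearMap.trace ℂ (Π i, Matrix (Fin (d i)) (Fin (d i)) ℂ) (LinearMap.mulLeft ℂ (Φ a))
      = ∑ i, (d i : ℂ) * (Φ a i).trace := by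
    rw [LinearMap.trace_eq_matrix_trace ℂ
      (Pi.basis fun i => Matrix.stdBasis ℂ (Fin (d i)) (Fin (d i))),
      Matrix.trace, Fintype.sum_sigma]
    refine Finset.sum_congr rfl fun i _ => ?_
    rw [Fintype.sum_prod_type, Matrix.trace, Finset.mul_sum]
    refine Finset.sum_congr rfl fun k _ => ?_
    have : ∀ l, (LinearMap.toMatrix (Pi.basis fun i => Matrix.stdBasis ℂ (Fin (d i)) (Fin (d i)))
        (Pi.basis fun i => Matrix.stdBasis ℂ (Fin (d i)) (Fin (d i)))
        (LinearMap.mulLeft ℂ (Φ a))) ⟨i, (k, l)⟩ ⟨i, (k, l)⟩ = Φ a i k k := by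
      intro l
      rw [LinearMap.toMatrix_apply, Pi.basis_repr, LinearMap.mulLeft_apply, Pi.mul_apply,
        Pi.basis_apply, Pi.single_eq_same, Matrix.stdBasis_eq_single]
      change ((Φ a i * Matrix.single k l (1 : ℂ) : Matrix (Fin (d i)) (Fin (d i)) ℂ)) k l = _
      simp
    simp [Matrix.diag, this]
  rw [← h1, ← h2, ← LinearMap.trace_conj' (LinearMap.mulLeft ℂ a) Φ.toLinearEquiv]
  congr 1
  refine LinearMap.ext fun y => ?_
  have : Φ (a * Φ.symm y) = Φ a * y := by rw [map_mul, AlgEquiv.apply_symm_apply]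
  exact this

open Classical in
noncomputable def ext0 {G R : Type*} [Group G] [CommRing R] (C : Subgroup G) (l : C →* R) (y : G) : R :=
  if hc : y ∈ C then l ⟨y, hc⟩ else 0

theorem ext0_mul {G R : Type*} [Group G] [CommRing R] (C : Subgroup G) (l : C →* R) (y z : G)
    (hy : y ∈ C) : ext0 C l (y * z) = ext0 C l y * ext0 C l z := by
  unfold ext0
  by_cases hz : z ∈ C
  · rw [dif_pos hy, dif_pos hz, dif_pos (C.mul_mem hy hz), ← map_mul]; rfl
  · rw [dif_neg hz, dif_neg, mul_zero]
    rwa [C.mul_mem_cancel_left hy]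

noncomputable def indRep {G R : Type*} [Group G] [Finite G] [CommRing R] (C : Subgroup G)
    [Fintype (G ⧸ C)] [DecidableEq (G ⧸ C)]
    (l : C →* R) : G →* Matrix (G ⧸ C) (G ⧸ C) R where
  toFun h := Matrix.of fun s t => ext0 C l (s.out⁻¹ * h * t.out)
  map_one' := by
    ext s t
    rw [Matrix.of_apply, mul_one, Matrix.one_apply]
    split_ifs with hst
    · subst hst
      unfold ext0
      rw [dif_pos (by simp)]
      convert l.map_one
      simp
    · unfold ext0
      rw [dif_neg]
      rw [← QuotientGroup.eq]
      simpa using hst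
  map_mul' h k := by
    ext s u
    rw [Matrix.mul_apply, Matrix.of_apply]
    simp only [Matrix.of_apply]
    let t0 : G ⧸ C := QuotientGroup.mk (h⁻¹ * s.out)
    by_cases hk : t0.out⁻¹ * k * u.out ∈ C
    all_goals
    rw [Finset.sum_eq_single t0]
    · have e : s.out⁻¹ * h * t0.out ∈ C := by
        have : (QuotientGroup.mk (h⁻¹ * s.out) : G ⧸ C) = QuotientGroup.mk t0.out := by simp [t0]
        rw [QuotientGroup.eq] at this
        simpa [mul_assoc] using this
      rw [← ext0_mul _ _ _ _ e]
      congr 1; group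
    · intro t _ ht
      have : ext0 C l (s.out⁻¹ * h * t.out) = 0 := by
        unfold ext0
        rw [dif_neg]
        intro hc
        apply ht
        have : (QuotientGroup.mk (h⁻¹ * s.out) : G ⧸ C) = QuotientGroup.mk t.out := by
          rw [QuotientGroup.eq]; simpa [mul_assoc] using hc
        simp only [t0]
        rw [this]; simp
      rw [this, zero_mul]
    · simp

theorem indRep_trace {G R : Type*} [Group G] [Fintype G] [CommRing R] (C : Subgroup G)
    [Fintype (G ⧸ C)] [DecidableEq (G ⧸ C)] [Fintype C]
    (l : C →* R) (f : MonoidAlgebra R G) (hf : ∀ y h, f.coeff (y * h * y⁻¹) = f.coeff h) :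
    (MonoidAlgebra.lift R _ G (indRep C l) f).trace
      = (Fintype.card (G ⧸ C) : R) * ∑ c : C, f.coeff c * l c := by
  classical
  rw [MonoidAlgebra.lift_apply, Finsupp.sum_fintype _ _ (by simp), Matrix.trace_sum]
  simp only [Matrix.trace]
  rw [Finset.sum_comm]
  have key : ∀ s : G ⧸ C, ∑ h : G, f.coeff h • (indRep C l h).diag s = ∑ c : C, f.coeff c * l c := by
    intro s
    rw [← Equiv.sum_comp (MulAut.conj s.out).toEquiv]
    have : ∀ h : G, f.coeff ((MulAut.conj s.out).toEquiv h) •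
        (indRep C l ((MulAut.conj s.out).toEquiv h)).diag s = f.coeff h * ext0 C l h := by
      intro h
      change f.coeff (s.out * h * (s.out)⁻¹) • ext0 C l (s.out⁻¹ * (s.out * h * (s.out)⁻¹) * s.out) = _
      rw [hf, smul_eq_mul]
      congr 2; group
    simp only [this]
    symm
    rw [← Finset.sum_subset (Finset.subset_univ (Finset.univ.filter (· ∈ C)))]
    · rw [Finset.sum_subtype (p := (· ∈ C)) _ (by simp)]
      refine Finset.sum_congr rfl fun c _ => ?_
      unfold ext0
      rw [dif_pos c.2]
    · intro h _ hh
      unfold ext0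
      rw [dif_neg (by simpa using hh), mul_zero]
  have : ∀ s : G ⧸ C, ∑ h : G, (f.coeff h • indRep C l h).diag s = ∑ c : C, f.coeff c * l c := by
    intro s; rw [← key s]; rfl
  rw [Finset.sum_congr rfl fun s _ => this s]
  simp

open Classical in
noncomputable def clSum {G : Type*} (R : Type*) [Group G] [Fintype G] [CommRing R] (x : G) : MonoidAlgebra R G :=
  ∑ y ∈ Finset.univ.filter (IsConj x), MonoidAlgebra.single y 1

theorem clSum_comm {G R : Type*} [Group G] [Fintype G] [CommRing R] (x h : G) :
    MonoidAlgebra.single h 1 * clSum R x = clSum R x * MonoidAlgebra.single h 1 := by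
  classical
  unfold clSum
  rw [Finset.mul_sum, Finset.sum_mul]
  simp only [MonoidAlgebra.single_mul_single, mul_one]
  refine Finset.sum_bij (fun y _ => h * y * h⁻¹) ?_ ?_ ?_ ?_
  · intro y hy
    simp only [Finset.mem_filter, Finset.mem_univ, true_and] at hy ⊢
    exact hy.trans (isConj_iff.2 ⟨h, rfl⟩)
  · intro a _ b _ hab
    simpa using hab
  · intro b hb
    simp only [Finset.mem_filter, Finset.mem_univ, true_and] at hb
    refine ⟨h⁻¹ * b * h, ?_, by group⟩
    simp only [Finset.mem_filter, Finset.mem_univ, true_and]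
    exact hb.trans (isConj_iff.2 ⟨h⁻¹, by group⟩)
  · intro a _
    congr 1; group

theorem central_all {G R : Type*} [Group G] [CommRing R] (z : MonoidAlgebra R G)
    (h : ∀ g : G, MonoidAlgebra.single g 1 * z = z * MonoidAlgebra.single g 1) (a : MonoidAlgebra R G) :
    a * z = z * a := by
  induction a using MonoidAlgebra.induction_linear with
  | zero => simp
  | add a b ha hb => rw [add_mul, mul_add, ha, hb]
  | single g c =>
    have : MonoidAlgebra.single g c = c • (MonoidAlgebra.single g 1 : MonoidAlgebra R G) := by simp
    rw [this, smul_mul_assoc, mul_smul_comm, h]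

theorem phi_scalar {G : Type*} [Group G] [Fintype G] {n : ℕ} {d : Fin n → ℕ}
    (Φ : MonoidAlgebra ℂ G ≃ₐ[ℂ] Π i, Matrix (Fin (d i)) (Fin (d i)) ℂ) (z : MonoidAlgebra ℂ G)
    (h : ∀ a, a * z = z * a) (i : Fin n) : ∃ w : ℂ, Φ z i = algebraMap ℂ _ w := by
  have : Φ z i ∈ Set.range (Matrix.scalar (Fin (d i))) := by
    rw [Matrix.mem_range_scalar_iff_commute_single']
    intro k l
    have := congrFun (congrArg Φ (h (Φ.symm (Pi.single i (Matrix.single k l 1))))) i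
    rw [map_mul, map_mul, AlgEquiv.apply_symm_apply, Pi.mul_apply, Pi.mul_apply,
      Pi.single_eq_same] at this
    exact this
  obtain ⟨w, hw⟩ := this
  exact ⟨w, hw.symm⟩

theorem clSum_map {G R S : Type*} [Group G] [Fintype G] [CommRing R] [CommRing S] (x : G) (f : R →+* S) :
    MonoidAlgebra.mapRingHom G f (clSum R x) = clSum S x := by
  classical
  unfold clSum
  rw [map_sum]
  simp

theorem omega_spec {G : Type*} [Group G] [Fintype G] {n : ℕ} {d : Fin n → ℕ} (hd : ∀ i, NeZero (d i))
    (Φ : MonoidAlgebra ℂ G ≃ₐ[ℂ] Π i, Matrix (Fin (d i)) (Fin (d i)) ℂ) (x : G) (i : Fin n) :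
    ∃ w : ℂ, Φ (clSum ℂ x) i = algebraMap ℂ _ w ∧ IsIntegral ℤ w ∧
      (Nat.card {z | IsConj x z} : ℂ) * (Φ (MonoidAlgebra.single x 1) i).trace = d i * w := by
  classical
  obtain ⟨w, hw⟩ := phi_scalar Φ (clSum ℂ x) (central_all _ (clSum_comm x)) i
  refine ⟨w, hw, ?_, ?_⟩
  · have h1 : IsIntegral ℤ (clSum ℤ x) := by
      have : Module.Finite ℤ (MonoidAlgebra ℤ G) := Module.Finite.of_basis (MonoidAlgebra.basis G ℤ)
      exact Algebra.IsIntegral.isIntegral _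
    have h2 : IsIntegral ℤ (Φ (clSum ℂ x) i) := by
      rw [← clSum_map x (Int.castRingHom ℂ)]
      let ψ : MonoidAlgebra ℤ G →+* Matrix (Fin (d i)) (Fin (d i)) ℂ :=
        ((Pi.evalRingHom (fun i => Matrix (Fin (d i)) (Fin (d i)) ℂ) i).comp
          (Φ : MonoidAlgebra ℂ G →+* Π i, Matrix (Fin (d i)) (Fin (d i)) ℂ)).comp
        (MonoidAlgebra.mapRingHom G (Int.castRingHom ℂ))
      exact h1.map ψ.toIntAlgHom
    rw [hw] at h2
    have := hd i
    exact (isIntegral_algHom_iff (IsScalarTower.toAlgHom ℤ ℂ (Matrix (Fin (d i)) (Fin (d i)) ℂ))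
      (algebraMap ℂ (Matrix (Fin (d i)) (Fin (d i)) ℂ)).injective).1 h2
  · have h1 : (Φ (clSum ℂ x) i).trace = d i * w := by
      rw [hw, Matrix.algebraMap_eq_diagonal]; simp [Matrix.trace, Matrix.diag]
    rw [← h1]
    unfold clSum
    rw [map_sum, Finset.sum_apply, Matrix.trace_sum, Finset.sum_congr rfl
      (g := fun _ => (Φ (MonoidAlgebra.single x 1) i).trace)]
    · rw [Finset.sum_const, nsmul_eq_mul]
      congr 2
      rw [Nat.card_eq_fintype_card, Fintype.card_subtype]; rfl
    · intro y hy
      simp only [Finset.mem_filter, Finset.mem_univ, true_and] at hy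
      obtain ⟨c, rfl⟩ := isConj_iff.1 hy
      have : (MonoidAlgebra.single (c * x * c⁻¹) 1 : MonoidAlgebra ℂ G)
        = MonoidAlgebra.single c 1 * MonoidAlgebra.single x 1 * MonoidAlgebra.single c⁻¹ 1 := by simp
      rw [this, map_mul, map_mul, Pi.mul_apply, Pi.mul_apply, Matrix.trace_mul_comm, ← mul_assoc]
      have h3 : Φ (MonoidAlgebra.single c⁻¹ 1) i * Φ (MonoidAlgebra.single c 1) i = 1 := by
        rw [← Pi.mul_apply, ← map_mul, MonoidAlgebra.single_mul_single, inv_mul_cancel, mul_one,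
          ← MonoidAlgebra.one_def, map_one, Pi.one_apply]
      rw [h3, one_mul]

theorem block_lemma {G : Type*} [Group G] [Fintype G] {n : ℕ} {d : Fin n → ℕ} (hd : ∀ i, NeZero (d i))
    (Φ : MonoidAlgebra ℂ G ≃ₐ[ℂ] Π i, Matrix (Fin (d i)) (Fin (d i)) ℂ) (x : G)
    (w : Fin n → ℂ) (hw : ∀ i, Φ (clSum ℂ x) i = algebraMap ℂ _ (w i))
    (hint : ∀ i, IsIntegral ℤ (w i)) (r : ℕ) (hr : r.Prime) (C : Subgroup G) [Fintype C]
    (hC : ∀ c : C, c ^ r = 1) (l : C →* ℂ) :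
    ∃ A : Finset (Fin n), (∀ i ∈ A, w i ≠ 0) ∧
      (∀ i, ∀ m k : ℕ, k ≠ 0 → Nat.Coprime m r → w i ^ k = m → i ∈ A) ∧
      ∑ i ∈ A, (d i : ℂ) * ∑ c : C,
        (Φ (MonoidAlgebra.single (c : G)⁻¹ 1) i).trace * (1 - l c) = 0 := by
  classical
  obtain ⟨O, hO, hchar⟩ := exists_val r hr
  have : Fact r.Prime := ⟨hr⟩
  let wO : Fin n → O := fun i => ⟨w i, hO _ (hint i)⟩
  let A : Finset (Fin n) := Finset.univ.filter fun i => IsUnit (wO i)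
  have hA : ∀ i, i ∈ A ↔ IsUnit (wO i) := by intro i; simp [A]
  have hcop : IsCoprime (∏ i ∈ A, (Polynomial.X - Polynomial.C (wO i)))
      (∏ i ∈ Aᶜ, (Polynomial.X - Polynomial.C (wO i))) := by
    refine IsCoprime.prod_left fun i hi => IsCoprime.prod_right fun j hj => ?_
    apply Polynomial.isCoprime_X_sub_C_of_isUnit_sub
    rw [hA] at hi
    rw [Finset.mem_compl, hA] at hj
    by_contra hc
    apply (IsLocalRing.mem_maximalIdeal _).1
      (add_mem ((IsLocalRing.mem_maximalIdeal _).2 hc) ((IsLocalRing.mem_maximalIdeal _).2 hj))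
    simpa using hi
  obtain ⟨a, b, hab⟩ := hcop
  set u := ∏ i ∈ A, (Polynomial.X - Polynomial.C (wO i)) with hu
  set v := ∏ i ∈ Aᶜ, (Polynomial.X - Polynomial.C (wO i)) with hv
  have hu0 : ∀ i ∈ A, u.eval (wO i) = 0 := by
    intro i hi
    rw [hu, Polynomial.eval_prod]
    exact Finset.prod_eq_zero hi (by simp)
  have hv0 : ∀ i ∉ A, v.eval (wO i) = 0 := by
    intro i hi
    rw [hv, Polynomial.eval_prod]
    exact Finset.prod_eq_zero (Finset.mem_compl.2 hi) (by simp)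
  let q := b * v
  have hq : ∀ i, q.eval (wO i) = if i ∈ A then 1 else 0 := by
    intro i
    split_ifs with hi
    · have := congrArg (Polynomial.eval (wO i)) hab
      rw [Polynomial.eval_add, Polynomial.eval_mul, hu0 i hi, mul_zero, zero_add,
        Polynomial.eval_one] at this
      exact this
    · simp [q, hv0 i hi]
  let ι : O →+* ℂ := algebraMap O ℂ
  have hι : Function.Injective ι := Subtype.val_injective
  let π : MonoidAlgebra O G →+* MonoidAlgebra ℂ G := MonoidAlgebra.mapRingHom G ι
  have hπc : ∀ f h, (π f).coeff h = ι (f.coeff h) := by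
    intro f h
    simp [π]
  have hπ : Function.Injective π := by
    intro f g hfg
    ext h
    have := congrArg (fun z => z.coeff h) hfg
    simp only [hπc] at this
    exact congrArg Subtype.val (hι this)
  let f : MonoidAlgebra O G := Polynomial.eval₂ (algebraMap O (MonoidAlgebra O G)) (clSum O x) q
  have hf : ∀ i, Φ (π f) i = if i ∈ A then 1 else 0 := by
    intro i
    let ψ : MonoidAlgebra O G →+* Matrix (Fin (d i)) (Fin (d i)) ℂ :=
        ((Pi.evalRingHom (fun i => Matrix (Fin (d i)) (Fin (d i)) ℂ) i).comp
          (Φ : MonoidAlgebra ℂ G →+* Π i, Matrix (Fin (d i)) (Fin (d i)) ℂ)).comp π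
    have h1 : ψ.comp (algebraMap O (MonoidAlgebra O G))
        = ((algebraMap ℂ (Matrix (Fin (d i)) (Fin (d i)) ℂ)).comp ι) := by
      ext1 c
      have : π (algebraMap O (MonoidAlgebra O G) c) = algebraMap ℂ (MonoidAlgebra ℂ G) (ι c) := by
        simp [π]
      change Φ (π (algebraMap O (MonoidAlgebra O G) c)) i = _
      rw [this, AlgEquiv.commutes]; rfl
    have h2 : ψ (clSum O x) = algebraMap ℂ _ (ι (wO i)) := by
      change Φ (π (clSum O x)) i = _
      rw [clSum_map, hw]; rfl
    have h3 : ψ f = algebraMap ℂ _ (ι (q.eval (wO i))) := by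
      simp only [f]
      rw [Polynomial.hom_eval₂, h1, h2, ← Polynomial.eval₂_id, Polynomial.hom_eval₂,
        Polynomial.hom_eval₂]; rfl
    change ψ f = _
    rw [h3, hq]
    split_ifs <;> simp
  have hinj : Function.Injective (fun f => Φ (π f)) := Φ.injective.comp hπ
  have hidem : f * f = f := by
    apply hinj
    funext i
    simp only [map_mul, Pi.mul_apply, hf]
    split_ifs <;> simp
  have hcent : ∀ a, a * f = f * a := by
    intro a
    apply hinj
    funext i
    simp only [map_mul, Pi.mul_apply, hf]
    split_ifs <;> simp
  have hcl : ∀ y h, f.coeff (y * h * y⁻¹) = f.coeff h := by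
    intro y h
    have := congrArg (fun z => z.coeff (y * h)) (hcent (MonoidAlgebra.single y 1))
    rw [MonoidAlgebra.coeff_single_mul_eq_mul_coeff h (by simp),
      MonoidAlgebra.coeff_mul_single_eq_coeff_mul (y * h * y⁻¹)
        (by intro m' _; exact eq_mul_inv_iff_mul_eq.symm)] at this
    simpa using this.symm
  have hlpow : ∀ c, l c ^ r = 1 := by intro c; rw [← map_pow, hC, map_one]
  let lO : C →* O :=
    { toFun := fun c => ⟨l c, hO _ (IsIntegral.of_pow hr.pos (by rw [hlpow]; exact isIntegral_one))⟩
      map_one' := by apply Subtype.ext; simp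
      map_mul' := by intro a b; apply Subtype.ext; simp }
  have hres : ∀ c, IsLocalRing.residue O (lO c) = 1 := by
    intro c
    have h1 : IsLocalRing.residue O (lO c) ^ r = 1 := by
      rw [← map_pow, ← map_pow, hC, map_one, map_one]
    have h2 : (IsLocalRing.residue O (lO c) - 1) ^ r = 0 := by
      rw [sub_pow_char, h1, one_pow, sub_self]
    exact sub_eq_zero.1 (pow_eq_zero_iff hr.ne_zero |>.1 h2)
  have hext : ∀ y, IsLocalRing.residue O (ext0 C 1 y) = IsLocalRing.residue O (ext0 C lO y) := by
    intro y
    unfold ext0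
    split_ifs with h
    · rw [hres]; simp
    · rfl
  have htr := idem_trace (MonoidAlgebra.lift O _ G (indRep C 1) f)
    (MonoidAlgebra.lift O _ G (indRep C lO) f) (by rw [← map_mul, hidem])
    (by rw [← map_mul, hidem]) (by
      intro i j
      rw [MonoidAlgebra.lift_apply, MonoidAlgebra.lift_apply, Finsupp.sum_fintype _ _ (by simp),
        Finsupp.sum_fintype _ _ (by simp), Matrix.sum_apply, Matrix.sum_apply, map_sum, map_sum]
      refine Finset.sum_congr rfl fun h _ => ?_
      rw [Matrix.smul_apply, Matrix.smul_apply, smul_eq_mul, smul_eq_mul, map_mul, map_mul]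
      congr 1
      exact hext _)
  rw [indRep_trace _ _ _ hcl, indRep_trace _ _ _ hcl] at htr
  have htr2 := congrArg ι htr
  rw [map_mul, map_mul, map_natCast] at htr2
  have htr3 := mul_left_cancel₀ (by exact_mod_cast Fintype.card_ne_zero) htr2
  have hfc : ∀ c : G, (Fintype.card G : ℂ) * ι (f.coeff c)
      = ∑ i ∈ A, (d i : ℂ) * (Φ (MonoidAlgebra.single c⁻¹ 1) i).trace := by
    intro c
    have := trace_formula Φ (MonoidAlgebra.single c⁻¹ 1 * π f)
    rw [MonoidAlgebra.coeff_single_mul_eq_mul_coeff c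
      (by intro m' _; rw [inv_mul_eq_one]; exact eq_comm), one_mul, hπc] at this
    rw [this, ← Finset.sum_subset (Finset.subset_univ A)]
    · refine Finset.sum_congr rfl fun i hi => ?_
      rw [map_mul, Pi.mul_apply, hf, if_pos hi, mul_one]
    · intro i _ hi
      rw [map_mul, Pi.mul_apply, hf, if_neg hi, mul_zero]; simp
  refine ⟨A, ?_, ?_, ?_⟩
  · intro i hi h0
    rw [hA] at hi
    apply hi.ne_zero
    exact Subtype.ext h0
  · intro i m k hk hm hwm
    rw [hA]
    by_contra hc
    have h1 : IsLocalRing.residue O (wO i) = 0 := by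
      rwa [IsLocalRing.residue_eq_zero_iff, IsLocalRing.mem_maximalIdeal]
    have h2 : wO i ^ k = (m : O) := by
      apply Subtype.ext; simpa using hwm
    have h3 := congrArg (IsLocalRing.residue O) h2
    rw [map_pow, h1, zero_pow hk, map_natCast] at h3
    have := (CharP.cast_eq_zero_iff _ r m).1 h3.symm
    have h4 := Nat.dvd_gcd this (dvd_refl r)
    rw [hm] at h4
    exact hr.one_lt.ne' (Nat.dvd_one.1 h4)
  · have e1 : ∑ c : C, ι (f.coeff c) * (1 - l c) = 0 := by
      simp only [map_sum, map_mul] at htr3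
      simp only [mul_sub, Finset.sum_sub_distrib, sub_eq_zero]
      convert htr3 using 3
      · simp
      · rfl
    have e2 : ∑ c : C, ((Fintype.card G : ℂ) * ι (f.coeff c)) * (1 - l c) = 0 := by
      simp only [mul_assoc]
      rw [← Finset.mul_sum, e1, mul_zero]
    rw [← e2]
    simp only [hfc, Finset.sum_mul, Finset.mul_sum]
    rw [Finset.sum_comm]
    simp only [mul_assoc]

theorem trace_int {d : ℕ} (X : Matrix (Fin d) (Fin d) ℂ) (e : ℕ) (he : 0 < e)
    (hX : X ^ e = 1) : IsIntegral ℤ X.trace := by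
  rcases Nat.eq_zero_or_pos d with rfl | hd
  · simpa [Matrix.trace] using isIntegral_zero
  have : Nonempty (Fin d) := ⟨⟨0, hd⟩⟩
  rw [Matrix.trace_eq_sum_roots_charpoly_of_splits (IsAlgClosed.splits _)]
  apply IsIntegral.multiset_sum
  intro z hz
  have h1 : z ∈ spectrum ℂ X := by
    rw [Matrix.mem_spectrum_iff_isRoot_charpoly]
    exact Polynomial.isRoot_of_mem_roots hz
  have h2 := spectrum.pow_mem_pow X e h1
  rw [hX, spectrum.one_eq] at h2
  have h3 : z ^ e = 1 := h2
  exact IsIntegral.of_pow he (by rw [h3]; exact isIntegral_one)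

theorem dvd_of_int (N p : ℕ) (hp : p ≠ 0) (b : ℂ) (hb : IsIntegral ℤ b) (h : (N : ℂ) + p * b = 0) :
    p ∣ N := by
  have h1 : b = algebraMap ℚ ℂ (-(N / p : ℚ)) := by
    have : (p : ℂ) ≠ 0 := by exact_mod_cast hp
    rw [map_neg, map_div₀, map_natCast, map_natCast]
    field_simp
    linear_combination h
  rw [h1] at hb
  have h2 : IsIntegral ℤ (-(N / p : ℚ)) := 
    (isIntegral_algHom_iff (IsScalarTower.toAlgHom ℤ ℚ ℂ) (algebraMap ℚ ℂ).injective).1 hb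
  obtain ⟨m, hm⟩ := IsIntegrallyClosed.isIntegral_iff.1 h2
  have h3 : (N : ℚ) = p * (-m : ℤ) := by
    have : (p : ℚ) ≠ 0 := by exact_mod_cast hp
    simp only [eq_intCast] at hm
    push_cast
    rw [hm]; field_simp
  have h4 : (N : ℤ) = p * (-m) := by exact_mod_cast h3
  exact Int.natCast_dvd_natCast.1 ⟨_, h4⟩

theorem tr_pow_one {d : ℕ} (hd : d = 1) (X : Matrix (Fin d) (Fin d) ℂ) (r : ℕ) (h : X ^ r = 1) :
    X.trace ^ r = 1 := by
  subst hd
  have : X.trace = X.det := by simp [Matrix.trace]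
  rw [this, ← Matrix.det_pow, h, Matrix.det_one]

theorem d_one {d : ℕ} (hd : d ≠ 0) (h : ∀ X Y : Matrix (Fin d) (Fin d) ℂ, X * Y = Y * X) : d = 1 := by
  by_contra hc
  have h2 : 1 < d := by omega
  have := h (Matrix.single ⟨0, by omega⟩ ⟨1, h2⟩ 1) (Matrix.single ⟨1, h2⟩ ⟨0, by omega⟩ 1)
  have := congrFun (congrFun this ⟨0, by omega⟩) ⟨0, by omega⟩
  simp at this

theorem core {G : Type*} [Group G] [Fintype G] (M : Subgroup G) [M.Normal] (x : G) (p r k : ℕ)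
    (hp : p.Prime) (hr : r.Prime) (hpr : p ≠ r) (hx : x ^ r = 1)
    (h : Nat.card {z | IsConj x z} = p ^ k) (hxc : ∃ h, x * h ≠ h * x)
    (hmin : ∀ L : Subgroup G, L.Normal → L ≠ ⊥ → M ≤ L)
    (hgen : ∀ g : G, ∃ m ∈ M, ∃ j : ℕ, g = m * x ^ j)
    (g : G) (hgM : g ∈ M) (hg : orderOf g = r) : False := by
  classical
  obtain ⟨n, d, hd, ⟨Φ⟩⟩ :=
    IsSemisimpleRing.exists_algEquiv_pi_matrix_of_isAlgClosed ℂ (MonoidAlgebra ℂ G)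
  have hd0 : ∀ i, d i ≠ 0 := fun i => (hd i).out
  choose w hw hwi hwt using omega_spec hd Φ x
  have hgr : g ^ r = 1 := by rw [← hg]; exact pow_orderOf_eq_one g
  let C := Subgroup.zpowers g
  have hC : ∀ c : C, c ^ r = 1 := by
    rintro ⟨c, j, rfl⟩
    apply Subtype.ext
    change (g ^ j) ^ r = 1
    rw [← zpow_natCast, ← zpow_mul, mul_comm, zpow_mul, zpow_natCast, hgr, one_zpow]
  have hCcard : Fintype.card C = r := by
    rw [← Nat.card_eq_fintype_card, Nat.card_zpowers, hg]
  have hCM : ∀ c : C, (c : G) ∈ M := by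
    intro c
    exact (Subgroup.zpowers_le.2 hgM) c.2
  obtain ⟨l0, hl0⟩ : ∃ l0 : C →* ℂˣ, l0 ⟨g, Subgroup.mem_zpowers g⟩ ≠ 1 := by
    have hg1 : (⟨g, Subgroup.mem_zpowers g⟩ : C) ≠ 1 := by
      intro hc
      have : g = 1 := congrArg Subtype.val hc
      rw [this, orderOf_one] at hg
      exact hr.one_lt.ne hg
    let _ : CommGroup C := 
      { (inferInstance : Group C) with
        mul_comm := by
          rintro ⟨_, i, rfl⟩ ⟨_, j, rfl⟩
          exact Subtype.ext (zpow_mul_comm g i j) }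
    exact CommGroup.exists_apply_ne_one_of_hasEnoughRootsOfUnity C ℂ hg1
  let l : C →* ℂ := (Units.coeHom ℂ).comp l0
  have hl : ∑ c : C, l c = 0 := by
    apply sum_hom_units_eq_zero
    intro hc
    apply hl0
    apply Units.ext
    exact DFunLike.congr_fun hc _
  obtain ⟨A, hA1, hA2, hA3⟩ := block_lemma hd Φ x w hw hwi r hr C hC l
  let R : ∀ i, G →* Matrix (Fin (d i)) (Fin (d i)) ℂ := fun i =>
    ((Pi.evalMonoidHom (fun i => Matrix (Fin (d i)) (Fin (d i)) ℂ) i).comp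
      (Φ : MonoidAlgebra ℂ G →* Π i, Matrix (Fin (d i)) (Fin (d i)) ℂ)).comp (MonoidAlgebra.of ℂ G)
  have hR : ∀ i y, Φ (MonoidAlgebra.single y 1) i = R i y := fun i y => rfl
  have hRint : ∀ i y, IsIntegral ℤ (R i y).trace := by
    intro i y
    refine trace_int _ (Fintype.card G) Fintype.card_pos ?_
    rw [← map_pow, pow_card_eq_one, map_one]
  let B : Finset (Fin n) := Finset.univ.filter fun i => ∀ m ∈ M, R i m = 1
  have hB : ∀ i, i ∈ B ↔ ∀ m ∈ M, R i m = 1 := by intro i; simp [B]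
  have hker : ∀ i, i ∉ B → ∀ y, R i y = 1 → y = 1 := by
    intro i hi
    by_contra! hc
    obtain ⟨y, hy, hy1⟩ := hc
    apply hi
    rw [hB]
    have := hmin (R i).ker inferInstance (by
      intro hbot
      apply hy1
      have : y ∈ (R i).ker := hy
      rwa [hbot, Subgroup.mem_bot] at this)
    exact fun m hm => this hm
  have hdvd : ∀ i ∈ A, i ∉ B → p ∣ d i := by
    intro i hiA hiB
    by_contra hnd
    have hcop : IsCoprime ((p ^ k : ℕ) : ℤ) (d i : ℤ) := by
      rw [Nat.isCoprime_iff_coprime]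
      exact Nat.Coprime.pow_left _ ((Nat.Prime.coprime_iff_not_dvd hp).2 hnd)
    obtain ⟨a, b, hab⟩ := hcop
    have hdi : (d i : ℂ) ≠ 0 := by exact_mod_cast hd0 i
    have ht := hwt i
    rw [hR, h] at ht
    have htr0 : (R i x).trace ≠ 0 := by
      intro h0
      rw [h0, mul_zero] at ht
      exact mul_ne_zero hdi (hA1 i hiA) ht.symm
    have hab' : (a : ℂ) * (p ^ k : ℕ) + b * d i = 1 := by exact_mod_cast hab
    have hti : IsIntegral ℤ ((R i x).trace / d i) := by
      have : (R i x).trace / d i = (a : ℤ) • w i + (b : ℤ) • (R i x).trace := by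
        rw [zsmul_eq_mul, zsmul_eq_mul, div_eq_iff hdi]
        linear_combination (-(R i x).trace) * hab' + (a : ℂ) * ht
      rw [this]
      exact ((hwi i).smul _).add ((hRint i x).smul _)
    obtain ⟨α, hα⟩ := scalar_of_integral (R i x) r hr.pos (by rw [← map_pow, hx, map_one]) hti htr0
    obtain ⟨y, hy⟩ := hxc
    apply hy
    have h1 : R i (x * y) = R i (y * x) := by
      rw [map_mul, map_mul, hα, Algebra.commutes]
    have h2 : R i (x * y * (y * x)⁻¹) = 1 := by
      rw [map_mul, h1, ← map_mul, mul_inv_cancel, map_one]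
    exact mul_inv_eq_one.1 (hker i hiB _ h2)
  have hBd : ∀ i ∈ B, d i = 1 := by
    intro i hi
    rw [hB] at hi
    have hcomm : ∀ y z, R i y * R i z = R i z * R i y := by
      intro y z
      obtain ⟨m, hm, j, rfl⟩ := hgen y
      obtain ⟨m', hm', j', rfl⟩ := hgen z
      rw [map_mul, map_mul, hi m hm, hi m' hm', one_mul, one_mul, ← map_mul, ← map_mul, ← pow_add,
        ← pow_add, add_comm]
    have hc2 : ∀ z, ∀ a : MonoidAlgebra ℂ G, Φ a i * R i z = R i z * Φ a i := by
      intro z a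
      induction a using MonoidAlgebra.induction_linear with
      | zero => simp
      | add a b ha hb => rw [map_add, Pi.add_apply, add_mul, mul_add, ha, hb]
      | single y c =>
        have : MonoidAlgebra.single y c = c • (MonoidAlgebra.single y 1 : MonoidAlgebra ℂ G) := by simp
        rw [this, map_smul, Pi.smul_apply, smul_mul_assoc, mul_smul_comm, hR, hcomm]
    have hc3 : ∀ b a : MonoidAlgebra ℂ G, Φ a i * Φ b i = Φ b i * Φ a i := by
      intro b a
      induction b using MonoidAlgebra.induction_linear with
      | zero => simp
      | add a b ha hb => rw [map_add, Pi.add_apply, add_mul, mul_add, ha, hb]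
      | single y c =>
        have : MonoidAlgebra.single y c = c • (MonoidAlgebra.single y 1 : MonoidAlgebra ℂ G) := by simp
        rw [this, map_smul, Pi.smul_apply, smul_mul_assoc, mul_smul_comm, hR, hc2]
    apply d_one (hd0 i)
    intro X Y
    have := hc3 (Φ.symm (Pi.single i Y)) (Φ.symm (Pi.single i X))
    simpa using this
  have hBdc : ∀ i ∈ B, (d i : ℂ) = 1 := fun i hi => by exact_mod_cast hBd i hi
  have hBA : B ⊆ A := by
    intro i hi
    refine hA2 i ((p ^ k) ^ r) r hr.ne_zero ?_ ?_
    · exact Nat.Coprime.pow_left _ (Nat.Coprime.pow_left _ ((Nat.coprime_primes hp hr).2 hpr))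
    · have ht := hwt i
      rw [hR, h, hBdc i hi, one_mul] at ht
      rw [← ht, mul_pow, tr_pow_one (hBd i hi) _ r (by rw [← map_pow, hx, map_one])]
      push_cast; ring
  have hBtr : ∀ i ∈ B, ∀ m ∈ M, (R i m).trace = 1 := by
    intro i hi m hm
    rw [(hB i).1 hi m hm, Matrix.trace_one]; simp [hBd i hi]
  have hBcard : Fintype.card G = B.card * Fintype.card M := by
    let a : MonoidAlgebra ℂ G := ∑ m : M, MonoidAlgebra.single (m : G) 1
    have ha : ∀ i, Φ a i = ∑ m : M, R i m := by
      intro i; simp only [a, map_sum, Finset.sum_apply]; rfl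
    have hac : ∀ b, b * a = a * b := by
      apply central_all
      intro y
      simp only [a, Finset.mul_sum, Finset.sum_mul, MonoidAlgebra.single_mul_single, mul_one]
      rw [← Equiv.sum_comp (MulAut.conjNormal y : MulAut M).toEquiv
        (fun m : M => (MonoidAlgebra.single ((m : G) * y) 1 : MonoidAlgebra ℂ G))]
      refine Finset.sum_congr rfl fun m _ => ?_
      congr 1
      simp
    have hnot : ∀ i ∉ B, Φ a i = 0 := by
      intro i hi
      obtain ⟨t, ht⟩ := phi_scalar Φ a hac i
      rw [hB] at hi
      push Not at hi
      obtain ⟨m0, hm0, hne⟩ := hi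
      have h1 : R i m0 * Φ a i = Φ a i := by
        rw [ha, Finset.mul_sum, ← Equiv.sum_comp (Equiv.mulLeft (⟨m0, hm0⟩ : M)) (fun m : M => R i m)]
        refine Finset.sum_congr rfl fun m _ => ?_
        rw [← map_mul]; rfl
      rw [ht] at h1 ⊢
      by_cases ht0 : t = 0
      · rw [ht0, map_zero]
      · exfalso
        apply hne
        have h2 := congrArg (fun z => z * algebraMap ℂ (Matrix (Fin (d i)) (Fin (d i)) ℂ) t⁻¹) h1
        simp only [mul_assoc, ← map_mul, mul_inv_cancel₀ ht0, map_one, mul_one] at h2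
        exact h2
    have := trace_formula Φ a
    have hc1 : a.coeff 1 = 1 := by
      simp only [a, MonoidAlgebra.coeff_sum, MonoidAlgebra.coeff_single, Finsupp.finsetSum_apply]
      rw [Finset.sum_eq_single 1]
      · simp
      · intro b _ hb
        rw [Finsupp.single_apply, if_neg]
        intro hb1; exact hb (Subtype.ext hb1)
      · simp
    rw [hc1, mul_one, ← Finset.sum_subset (Finset.subset_univ B)] at this
    · rw [Finset.sum_congr rfl (g := fun _ => (Fintype.card M : ℂ))] at this
      · rw [Finset.sum_const, nsmul_eq_mul] at this
        exact_mod_cast this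
      · intro i hi
        rw [hBdc i hi, ha, Matrix.trace_sum, Finset.sum_congr rfl (fun (m : M) _ => hBtr i hi (m : G) m.2)]
        simp
    · intro i _ hi
      rw [hnot i hi]; simp
  have hBp : ¬ p ∣ B.card := by
    intro hpB
    have hidx : B.card = Nat.card (G ⧸ M) := by
      have h1 := Subgroup.card_eq_card_quotient_mul_card_subgroup M
      rw [Nat.card_eq_fintype_card, hBcard, Nat.card_eq_fintype_card (α := M)] at h1
      exact Nat.eq_of_mul_eq_mul_right Fintype.card_pos h1
    rw [hidx] at hpB
    have : Fact p.Prime := ⟨hp⟩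
    obtain ⟨y, hy⟩ := exists_prime_orderOf_dvd_card' p hpB
    induction y using QuotientGroup.induction_on with
    | H y =>
      obtain ⟨m, hm, j, rfl⟩ := hgen y
      have : ((m * x ^ j : G) : G ⧸ M) ^ r = 1 := by
        rw [QuotientGroup.mk_mul, (QuotientGroup.eq_one_iff m).2 hm, one_mul, ← QuotientGroup.mk_pow,
          ← pow_mul, mul_comm, pow_mul, hx, one_pow, QuotientGroup.mk_one]
      have := orderOf_dvd_of_pow_eq_one this
      rw [hy] at this
      exact hpr ((Nat.prime_dvd_prime_iff_eq hp hr).1 this)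
  have hfin : p ∣ B.card * r := by
    refine dvd_of_int _ p hp.ne_zero (∑ i ∈ A \ B, ((d i / p : ℕ) : ℂ) * ∑ c : C,
        (Φ (MonoidAlgebra.single (c : G)⁻¹ 1) i).trace * (1 - l c)) ?_ ?_
    · refine IsIntegral.sum _ fun i _ => IsIntegral.mul (isIntegral_natCast _) ?_
      refine IsIntegral.sum _ fun c _ => IsIntegral.mul (hRint i _) (IsIntegral.sub isIntegral_one ?_)
      refine IsIntegral.of_pow hr.pos ?_
      rw [← map_pow, hC, map_one]; exact isIntegral_one
    · rw [← hA3, ← Finset.sum_sdiff hBA, add_comm]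
      congr 1
      · rw [Finset.mul_sum]
        refine Finset.sum_congr rfl fun i hi => ?_
        rw [Finset.mem_sdiff] at hi
        rw [← mul_assoc, ← Nat.cast_mul, Nat.mul_div_cancel' (hdvd i hi.1 hi.2)]
      · rw [Finset.sum_congr rfl (g := fun _ => (r : ℂ))]
        · simp
        · intro i hi
          rw [hBdc i hi, one_mul]
          have : ∀ c : C, (Φ (MonoidAlgebra.single (c : G)⁻¹ 1) i).trace * (1 - l c) = 1 - l c := by
            intro c
            rw [hR, hBtr i hi _ (M.inv_mem (hCM c)), one_mul]
          simp only [this, Finset.sum_sub_distrib, hl]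
          simp [hCcard]
  rcases (Nat.Prime.dvd_mul hp).1 hfin with h1 | h1
  · exact hBp h1
  · exact hpr ((Nat.prime_dvd_prime_iff_eq hp hr).1 h1)

theorem solv_le {G : Type*} [Group G] {J K : Subgroup G} (h : J ≤ K) (hK : Group.IsSolvable K) :
    Group.IsSolvable J :=
  Group.isSolvable_of_isSolvable_injective (Subgroup.inclusion_injective h)

theorem solv_map {G H : Type*} [Group G] [Group H] {J : Subgroup G} (f : G →* H)
    (hJ : Group.IsSolvable J) : Group.IsSolvable (J.map f) :=
  Group.isSolvable_of_surjective (f.subgroupMap_surjective J)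

theorem solv_of_map {G H : Type*} [Group G] [Group H] (f : G →* H) (J L : Subgroup G)
    (hf : f.ker ≤ L) (h1 : Group.IsSolvable (J.map f)) (h2 : Group.IsSolvable (J ⊓ L : Subgroup G)) :
    Group.IsSolvable J := by
  refine Group.isSolvable_of_ker_le_range (Subgroup.inclusion (inf_le_left : J ⊓ L ≤ J)) (f.subgroupMap J) ?_
  intro a ha
  have h3 : f a = 1 := congrArg Subtype.val ha
  exact ⟨⟨a, a.2, hf h3⟩, rfl⟩

theorem solv_sup {G : Type*} [Group G] (J L : Subgroup G) [L.Normal]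
    (h1 : Group.IsSolvable J) (h2 : Group.IsSolvable L) : Group.IsSolvable (J ⊔ L : Subgroup G) := by
  refine solv_of_map (QuotientGroup.mk' L) _ L (by simp) ?_ (solv_le inf_le_right h2)
  rw [Subgroup.map_sup]
  have : L.map (QuotientGroup.mk' L) = ⊥ := by
    rw [Subgroup.map_eq_bot_iff]; simp
  rw [this, sup_bot_eq]
  exact solv_map _ h1

theorem rad_trivial {G : Type*} [Group G] [Finite G] (M : Subgroup G) [M.Normal]
    (hs : ∀ J : Subgroup G, J.Normal → Group.IsSolvable J → J = ⊥) :
    ∀ J : Subgroup M, J.Normal → Group.IsSolvable J → J = ⊥ := by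
  obtain ⟨R, hR⟩ := Set.Finite.exists_maximal
    (Set.toFinite {J : Subgroup M | J.Normal ∧ Group.IsSolvable J})
    ⟨⊥, inferInstance, inferInstance⟩
  have hRn : R.Normal := hR.prop.1
  have hRs : Group.IsSolvable R := hR.prop.2
  have hmax : ∀ J : Subgroup M, J.Normal → Group.IsSolvable J → J ≤ R := by
    intro J hJ hJs
    exact le_trans le_sup_left (hR.le_of_ge (y := J ⊔ R) ⟨inferInstance, solv_sup J R hJs hRs⟩ le_sup_right)
  have hchar : R.Characteristic := by
    rw [Subgroup.characteristic_iff_map_le]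
    intro φ
    exact hmax _ (hRn.map _ φ.surjective) (solv_map _ hRs)
  have h1 : (R.map M.subtype).Normal := inferInstance
  have h2 := hs _ h1 (solv_map _ hRs)
  rw [Subgroup.map_eq_bot_iff, Subgroup.ker_subtype, le_bot_iff] at h2
  intro J hJ hJs
  have := hmax J hJ hJs
  rwa [h2, le_bot_iff] at this

theorem exists_min {G : Type*} [Group G] [Finite G] (N : Subgroup G)
    (hN : ¬ Group.IsSolvable N)
    (hq : ∀ L : Subgroup G, (hL : L.Normal) → L ≠ ⊥ → Group.IsSolvable (N.map (QuotientGroup.mk' L))) :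
    (∀ J : Subgroup G, J.Normal → Group.IsSolvable J → J = ⊥) ∧
    ∃ M : Subgroup G, M.Normal ∧ M ≠ ⊥ ∧ ∀ L : Subgroup G, L.Normal → L ≠ ⊥ → M ≤ L := by
  have h1 : ∀ L : Subgroup G, L.Normal → L ≠ ⊥ → ¬ Group.IsSolvable (N ⊓ L : Subgroup G) := by
    intro L hL hne hs
    exact hN (solv_of_map (QuotientGroup.mk' L) N L (by simp) (hq L hL hne) hs)
  have h2 : ∀ L K : Subgroup G, L.Normal → K.Normal → L ≠ ⊥ → K ≠ ⊥ → L ⊓ K ≠ ⊥ := by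
    intro L K hL hK hL1 hK1 hLK
    apply h1 L hL hL1
    refine solv_of_map (QuotientGroup.mk' K) _ K (by simp)
      (solv_le (Subgroup.map_mono inf_le_left) (hq K hK hK1)) ?_
    have : N ⊓ L ⊓ K = ⊥ := by rw [inf_assoc, hLK, inf_bot_eq]
    rw [this]; infer_instance
  refine ⟨?_, ?_⟩
  · intro J hJ hs
    by_contra hne
    exact h1 J hJ hne (solv_le inf_le_right hs)
  have hNb : N ≠ ⊥ := by
    rintro rfl; exact hN inferInstance
  obtain ⟨M, hM⟩ := Set.Finite.exists_minimal
    (Set.toFinite {J : Subgroup G | J.Normal ∧ J ≠ ⊥})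
    ⟨⊤, inferInstance, fun h => hNb (le_bot_iff.1 (h ▸ le_top))⟩
  refine ⟨M, hM.prop.1, hM.prop.2, ?_⟩
  intro L hL hne
  have hMn : M.Normal := hM.prop.1
  exact le_trans (hM.le_of_le (y := M ⊓ L) ⟨inferInstance, h2 M L hMn hL hM.prop.2 hne⟩ inf_le_left) inf_le_right

theorem not_cent {G : Type*} [Group G] (M : Subgroup G) [M.Normal] (hMb : M ≠ ⊥)
    (hs : ∀ J : Subgroup G, J.Normal → Group.IsSolvable J → J = ⊥)
    (hmin : ∀ L : Subgroup G, L.Normal → L ≠ ⊥ → M ≤ L) (y : G) (hy : y ≠ 1)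
    (hc : ∀ m ∈ M, m * y = y * m) : False := by
  have h1 := hmin (Subgroup.centralizer M) inferInstance (by
    intro h
    apply hy
    have : y ∈ Subgroup.centralizer (M : Set G) := Subgroup.mem_centralizer_iff.2 hc
    rwa [h, Subgroup.mem_bot] at this)
  apply hMb
  apply hs M inferInstance
  apply Group.isSolvable_of_comm
  intro a b
  exact Subtype.ext (Subgroup.mem_centralizer_iff.1 (h1 b.2) a a.2)

theorem rel_nz {G : Type*} [Group G] [Finite G] (M C : Subgroup G) : M.relIndex C ≠ 0 :=
  Subgroup.index_ne_zero_of_finite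

theorem rel_dvd {G : Type*} [Group G] [Finite G] (M C : Subgroup G) [M.Normal] :
    C.relIndex M ∣ C.index := by
  have h1 : M.relIndex C * C.index = C.relIndex M * M.index := by
    rw [← Subgroup.inf_relIndex_right M C, ← Subgroup.inf_relIndex_left M C,
      Subgroup.relIndex_mul_index inf_le_right, Subgroup.relIndex_mul_index inf_le_left]
  obtain ⟨e, he⟩ := Subgroup.relIndex_dvd_index_of_normal M C
  refine ⟨e, ?_⟩
  have h0 : M.relIndex C ≠ 0 := rel_nz _ _
  apply Nat.eq_of_mul_eq_mul_left (Nat.pos_of_ne_zero h0)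
  rw [h1, he]; ring

theorem rel_eq {G : Type*} [Group G] [Finite G] (M C Y : Subgroup G) [M.Normal] (hY : Y ≤ C) :
    C.relIndex (M ⊔ Y) = C.relIndex M := by
  set H := M ⊔ Y with hH
  have h0 : M ⊔ (H ⊓ C) = H := by
    apply le_antisymm (sup_le le_sup_left inf_le_left)
    exact sup_le le_sup_left (le_trans (le_inf le_sup_right hY) le_sup_right)
  have h1 : M.relIndex (H ⊓ C) = M.relIndex H := by
    rw [← Subgroup.relIndex_sup_left, h0]
  have h2 : M.relIndex (C ⊓ H) * C.relIndex H = (M ⊓ C).relIndex H :=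
    Subgroup.relIndex_inf_mul_relIndex M C H
  have h3 : C.relIndex (M ⊓ H) * M.relIndex H = (C ⊓ M).relIndex H :=
    Subgroup.relIndex_inf_mul_relIndex C M H
  have h4 : M ⊓ H = M := inf_eq_left.2 le_sup_left
  rw [h4, inf_comm C M, ← h2, inf_comm C H, h1, mul_comm] at h3
  exact (Nat.eq_of_mul_eq_mul_left (Nat.pos_of_ne_zero (rel_nz _ _)) h3).symm

theorem cent_sub {G : Type*} [Group G] (H : Subgroup G) (y : H) :
    (Subgroup.centralizer {y}).index = (Subgroup.centralizer {(y : G)}).relIndex H := by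
  rw [Subgroup.relIndex]
  congr 1
  ext a
  simp only [Subgroup.mem_centralizer_iff, Subgroup.mem_subgroupOf, Set.mem_singleton_iff, forall_eq]
  exact Subtype.ext_iff

theorem cent_quot {G : Type*} [Group G] (L : Subgroup G) [L.Normal] (y : G) :
    (Subgroup.centralizer {(QuotientGroup.mk' L y)}).index ∣ (Subgroup.centralizer {y}).index := by
  refine dvd_trans (Subgroup.index_dvd_of_le ?_)
    (Subgroup.index_map_dvd _ (QuotientGroup.mk'_surjective L))
  rintro _ ⟨a, ha, rfl⟩
  have : y * a = a * y := by simpa [Subgroup.mem_centralizer_iff] using ha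
  simp only [Subgroup.mem_centralizer_iff, Set.mem_singleton_iff, forall_eq]
  rw [← map_mul, this, map_mul]

theorem cent_pow {G : Type*} [Group G] (y : G) (e : ℕ) :
    (Subgroup.centralizer {y ^ e}).index ∣ (Subgroup.centralizer {y}).index := by
  refine (Subgroup.index_dvd_of_le ?_)
  intro a ha
  have h : y * a = a * y := by simpa [Subgroup.mem_centralizer_iff] using ha
  simp only [Subgroup.mem_centralizer_iff, Set.mem_singleton_iff, forall_eq]
  exact (Commute.pow_left h e)

theorem card_conj {G : Type*} [Group G] (x : G) :
    Nat.card {z | IsConj x z} = (Subgroup.centralizer {x}).index := by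
  symm
  refine Nat.card_congr (Equiv.ofBijective (fun q => Quotient.liftOn' q (fun a => (⟨a * x * a⁻¹, isConj_iff.2 ⟨a, rfl⟩⟩ : {z | IsConj x z})) ?_) ⟨?_, ?_⟩)
  · intro a b hab
    rw [QuotientGroup.leftRel_apply] at hab
    have : x * (a⁻¹ * b) = a⁻¹ * b * x := by simpa [Subgroup.mem_centralizer_iff] using hab
    apply Subtype.ext
    calc a * x * a⁻¹ = a * (x * (a⁻¹ * b)) * b⁻¹ := by group
      _ = _ := by rw [this]; group
  · intro q q' hqq
    induction q using QuotientGroup.induction_on with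
    | H a =>
    induction q' using QuotientGroup.induction_on with
    | H b =>
    have h1 : a * x * a⁻¹ = b * x * b⁻¹ := congrArg Subtype.val hqq
    rw [QuotientGroup.eq, Subgroup.mem_centralizer_iff]
    simp only [Set.mem_singleton_iff, forall_eq]
    calc x * (a⁻¹ * b) = a⁻¹ * (a * x * a⁻¹) * b := by group
      _ = _ := by rw [h1]; group
  · rintro ⟨z, hz⟩
    obtain ⟨a, ha⟩ := isConj_iff.1 hz
    exact ⟨(a : G ⧸ Subgroup.centralizer {x}), Subtype.ext ha⟩

open Pointwise in
theorem aut_trivial {M : Type*} [Group M] [Finite M]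
    (hM : ∀ J : Subgroup M, J.Normal → Group.IsSolvable J → J = ⊥) (φ : MulAut M) (p r k : ℕ)
    (hp : p.Prime) (hr : r.Prime) (hφ : φ ^ r = 1) (hpr : r = p ∨ ¬ r ∣ Nat.card M)
    (F : Subgroup M) (hF : ∀ m ∈ F, φ m = m) (hk : F.index = p ^ k) : ∀ m, φ m = m := by
  have : Fact p.Prime := ⟨hp⟩
  have : Fact r.Prime := ⟨hr⟩
  have hnd : ¬ r ∣ Nat.card (Sylow p M) := by
    intro hd
    rcases hpr with rfl | h
    · have h1 := card_sylow_modEq_one r M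
      have h2 := (h1.dvd_iff dvd_rfl).1 hd
      exact hr.one_lt.ne' (Nat.dvd_one.1 h2)
    · exact h (hd.trans ((Sylow.card_dvd_index (default : Sylow p M)).trans (Subgroup.index_dvd_card _)))
  have hA : IsPGroup r (Subgroup.zpowers φ) := by
    rintro ⟨_, j, rfl⟩
    refine ⟨1, Subtype.ext ?_⟩
    change (φ ^ j) ^ (r ^ 1) = 1
    rw [pow_one, ← zpow_natCast, ← zpow_mul, mul_comm, zpow_mul, zpow_natCast, hφ, one_zpow]
  obtain ⟨P, hP⟩ := hA.nonempty_fixed_point_of_prime_not_dvd_card (Sylow p M) hnd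
  have hP1 : (⟨φ, Subgroup.mem_zpowers φ⟩ : Subgroup.zpowers φ) • P = P := hP _
  have hP2 : φ • (P : Subgroup M) = P := congrArg (fun Q : Sylow p M => (Q : Subgroup M)) hP1
  have hP3 : ∀ m ∈ (P : Subgroup M), φ m ∈ (P : Subgroup M) := by
    intro m hm
    have := Subgroup.smul_mem_pointwise_smul m φ _ hm
    rw [hP2] at this
    exact this
  have hcop : Nat.Coprime F.index (P : Subgroup M).index := by
    rw [hk]
    exact Nat.Coprime.pow_left _ ((Nat.Prime.coprime_iff_not_dvd hp).2 P.not_dvd_index)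
  have hrel : (P : Subgroup M).relIndex F = (P : Subgroup M).index := by
    have h1 : (P : Subgroup M).relIndex F * F.index = (P ⊓ F : Subgroup M).index := by
      rw [← Subgroup.inf_relIndex_right, Subgroup.relIndex_mul_index inf_le_right]
    have h2 : (P : Subgroup M).index ∣ (P ⊓ F : Subgroup M).index := Subgroup.index_dvd_of_le inf_le_left
    rw [← h1] at h2
    have h3 := hcop.symm.dvd_of_dvd_mul_right h2
    apply le_antisymm
    · rw [← Subgroup.relIndex_top_right (P : Subgroup M)]
      exact Subgroup.relIndex_le_of_le_right le_top (rel_nz _ _)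
    · exact Nat.le_of_dvd (Nat.pos_of_ne_zero (rel_nz _ _)) h3
  have hprod : ∀ m : M, ∃ f ∈ F, ∃ q ∈ (P : Subgroup M), m = f * q := by
    let T : F ⧸ (P : Subgroup M).subgroupOf F → M ⧸ (P : Subgroup M) :=
      fun q => Quotient.liftOn' q (fun f => ((f : M) : M ⧸ (P : Subgroup M))) (by
        intro a b hab
        rw [QuotientGroup.leftRel_apply, Subgroup.mem_subgroupOf] at hab
        exact QuotientGroup.eq.2 hab)
    have hT : Function.Bijective T := by
      rw [Nat.bijective_iff_injective_and_card]
      refine ⟨?_, hrel⟩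
      intro q q' hqq
      induction q using QuotientGroup.induction_on with
      | H a =>
      induction q' using QuotientGroup.induction_on with
      | H b =>
      have h1 : ((a : M) : M ⧸ (P : Subgroup M)) = ((b : M) : M ⧸ (P : Subgroup M)) := hqq
      rw [QuotientGroup.eq] at h1 ⊢
      exact h1
    intro m
    obtain ⟨q, hq⟩ := hT.2 (m : M ⧸ (P : Subgroup M))
    induction q using QuotientGroup.induction_on with
    | H a =>
    have h1 : ((a : M) : M ⧸ (P : Subgroup M)) = (m : M ⧸ (P : Subgroup M)) := hq
    rw [QuotientGroup.eq] at h1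
    exact ⟨a, a.2, _, h1, by group⟩
  have hcP : ∀ m, m⁻¹ * φ m ∈ (P : Subgroup M) := by
    intro m
    obtain ⟨f, hf, q, hq, rfl⟩ := hprod m
    rw [map_mul, hF f hf]
    have : (f * q)⁻¹ * (f * φ q) = q⁻¹ * φ q := by group
    rw [this]
    exact mul_mem (inv_mem hq) (hP3 q hq)
  have hcore : (P : Subgroup M).normalCore = ⊥ := by
    apply hM _ inferInstance
    refine solv_le (Subgroup.normalCore_le _) ?_
    have := P.isPGroup'.isNilpotent
    infer_instance
  intro m
  have h1 : m⁻¹ * φ m ∈ (P : Subgroup M).normalCore := by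
    intro b
    have : b * (m⁻¹ * φ m) * b⁻¹ = ((m * b⁻¹)⁻¹ * φ (m * b⁻¹)) * ((b⁻¹)⁻¹ * φ b⁻¹)⁻¹ := by
      rw [map_mul]; group
    rw [this]
    exact mul_mem (hcP _) (inv_mem (hcP _))
  rw [hcore, Subgroup.mem_bot] at h1
  exact (inv_mul_eq_one.1 h1).symm

theorem main_step {G : Type*} [Group G] [Finite G] (p : ℕ) (hp : p.Prime) (x : G) (k : ℕ)
    (h : (Subgroup.centralizer {x}).index = p ^ k)
    (ihq : ∀ L : Subgroup G, (hL : L.Normal) → L ≠ ⊥ → ∀ (y : G ⧸ L) (j : ℕ),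
      (Subgroup.centralizer {y}).index = p ^ j → Group.IsSolvable (Subgroup.normalClosure {y}))
    (ihs : ∀ H : Subgroup G, H ≠ ⊤ → ∀ (y : H) (j : ℕ),
      (Subgroup.centralizer {y}).index = p ^ j → Group.IsSolvable (Subgroup.normalClosure {y})) :
    Group.IsSolvable (Subgroup.normalClosure {x}) := by
  by_contra hN
  obtain ⟨hs, M, hMn, hMb, hmin⟩ := exists_min (Subgroup.normalClosure {x}) hN (by
    intro L hL hne
    rw [Subgroup.map_normalClosure _ _ (QuotientGroup.mk'_surjective L), Set.image_singleton]
    have h1 := cent_quot L x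
    rw [h] at h1
    obtain ⟨j, _, hj⟩ := (Nat.dvd_prime_pow hp).1 h1
    exact ihq L hL hne _ j hj)
  have hrad := rad_trivial M hs
  have hx1 : x ≠ 1 := by
    rintro rfl
    apply hN
    rw [Subgroup.normalClosure_eq_bot_iff.2 (by simp)]
    infer_instance
  have hord : orderOf x ≠ 1 := by rwa [Ne, orderOf_eq_one_iff]
  obtain ⟨r, hr, hrd⟩ := Nat.exists_prime_and_dvd hord
  obtain ⟨y, hyr, k', hyk⟩ : ∃ y : G, orderOf y = r ∧ ∃ k', (Subgroup.centralizer {y}).index = p ^ k' := by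
    refine ⟨x ^ (orderOf x / r), orderOf_pow_orderOf_div (orderOf_pos x).ne' hrd, ?_⟩
    have h1 := cent_pow x (orderOf x / r)
    rw [h] at h1
    obtain ⟨j, _, hj⟩ := (Nat.dvd_prime_pow hp).1 h1
    exact ⟨j, hj⟩
  clear hN ihq h hrd hord hx1
  have hyr1 : y ^ r = 1 := by rw [← hyr]; exact pow_orderOf_eq_one y
  have hy1 : y ≠ 1 := by
    rintro rfl
    rw [orderOf_one] at hyr
    exact hr.one_lt.ne hyr
  have hnc := not_cent M hMb hs hmin y hy1
  obtain ⟨e, he⟩ : ∃ e, (Subgroup.centralizer {y}).relIndex M = p ^ e := by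
    have h1 := rel_dvd M (Subgroup.centralizer {y})
    rw [hyk] at h1
    obtain ⟨j, _, hj⟩ := (Nat.dvd_prime_pow hp).1 h1
    exact ⟨j, hj⟩
  have htop : M ⊔ Subgroup.zpowers y = ⊤ := by
    by_contra hne
    set H := M ⊔ Subgroup.zpowers y with hH
    have hyH : y ∈ H := (le_sup_right : _ ≤ H) (Subgroup.mem_zpowers y)
    have hMH : M ≤ H := le_sup_left
    have h1 := ihs H hne ⟨y, hyH⟩ e (by
      rw [cent_sub, ← he]
      apply rel_eq
      rw [Subgroup.zpowers_le]
      simp [Subgroup.mem_centralizer_iff])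
    set K := Subgroup.normalClosure {(⟨y, hyH⟩ : H)} with hK
    have h2 : K.comap (Subgroup.inclusion hMH) = ⊥ := by
      apply hrad _ inferInstance
      refine Group.isSolvable_of_isSolvable_injective
        (f := (Subgroup.inclusion hMH).subgroupComap K) ?_
      intro a b hab
      have h3 : Subgroup.inclusion hMH a = Subgroup.inclusion hMH b := congrArg Subtype.val hab
      exact Subtype.ext (Subgroup.inclusion_injective hMH h3)
    apply hnc
    intro m hm
    have hm2 : m * y * m⁻¹ * y⁻¹ ∈ M := by
      have : m * y * m⁻¹ * y⁻¹ = m * (y * m⁻¹ * y⁻¹) := by group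
      rw [this]
      exact mul_mem hm (hMn.conj_mem _ (inv_mem hm) y)
    have h3 : (⟨_, hm2⟩ : M) ∈ K.comap (Subgroup.inclusion hMH) := by
      have h4 : (⟨y, hyH⟩ : H) ∈ K := Subgroup.subset_normalClosure rfl
      have h5 : (⟨m, hMH hm⟩ : H) * ⟨y, hyH⟩ * (⟨m, hMH hm⟩)⁻¹ * (⟨y, hyH⟩)⁻¹ ∈ K :=
        mul_mem (Subgroup.normalClosure_normal.conj_mem _ h4 _) (inv_mem h4)
      exact h5
    rw [h2, Subgroup.mem_bot] at h3
    have h6 : m * y * m⁻¹ * y⁻¹ = 1 := congrArg Subtype.val h3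
    rw [mul_inv_eq_one, mul_inv_eq_iff_eq_mul] at h6
    exact h6
  by_cases hcase : r = p ∨ ¬ r ∣ Nat.card M
  · apply hnc
    have h1 := aut_trivial hrad (MulAut.conjNormal y) p r e hp hr
      (by rw [← map_pow, hyr1, map_one]) hcase ((Subgroup.centralizer {y}).subgroupOf M) (by
        intro m hm
        have h2 : y * m = m * y := by
          simpa [Subgroup.mem_subgroupOf, Subgroup.mem_centralizer_iff] using hm
        apply Subtype.ext
        rw [MulAut.conjNormal_apply, h2]; group) he
    intro m hm
    have h2 := congrArg Subtype.val (h1 ⟨m, hm⟩)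
    rw [MulAut.conjNormal_apply] at h2
    exact (mul_inv_eq_iff_eq_mul.1 h2).symm
  · push Not at hcase
    have : Fact r.Prime := ⟨hr⟩
    obtain ⟨g, hg⟩ := exists_prime_orderOf_dvd_card' r hcase.2
    have := Fintype.ofFinite G
    refine core M y p r k' hp hr (Ne.symm hcase.1) hyr1 (by rw [card_conj, hyk]) ?_ hmin ?_ g g.2
      (by rw [Subgroup.orderOf_coe, hg])
    · by_contra! hc
      exact hnc fun m _ => (hc m).symm
    · intro a
      have ha : a ∈ M ⊔ Subgroup.zpowers y := by rw [htop]; trivial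
      obtain ⟨m, hm, z, hz, rfl⟩ := Subgroup.mem_sup_of_normal_left.1 ha
      obtain ⟨j, rfl⟩ := (mem_powers_iff_mem_zpowers.2 hz)
      exact ⟨m, hm, j, rfl⟩

theorem main_aux_s15 (p : ℕ) (hp : p.Prime) (n : ℕ) : ∀ (G : Type*) [Group G] [Finite G], Nat.card G = n →
    ∀ (x : G) (k : ℕ), (Subgroup.centralizer {x}).index = p ^ k →
      Group.IsSolvable (Subgroup.normalClosure {x}) := by
  induction n using Nat.strong_induction_on with
  | _ n ih =>
  intro G _ _ hn x k h
  refine main_step p hp x k h ?_ ?_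
  · intro L hL hne y j hj
    refine ih _ ?_ (G ⧸ L) rfl y j hj
    have h1 := Subgroup.card_eq_card_quotient_mul_card_subgroup L
    have h2 : 1 < Nat.card L := by
      have := (Subgroup.nontrivial_iff_ne_bot L).2 hne
      exact Finite.one_lt_card
    have h3 : 0 < Nat.card (G ⧸ L) := Nat.card_pos
    rw [← hn, h1]
    nlinarith
  · intro H hne y j hj
    refine ih _ ?_ H rfl y j hj
    rw [← hn]
    exact lt_of_le_of_ne (Subgroup.card_le_card_group H) fun hc => hne (Subgroup.eq_top_of_card_eq H hc)

/-- Kazarin's theorem (Lemma 2.1): if `|x^G|` is a prime power, then the normal closure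
`⟨x^G⟩` is solvable. In particular (Burnside's `p^α`-lemma), in a finite nonabelian simple
group no nontrivial conjugacy class has prime power size. -/
theorem stmt15 {G : Type*} [Group G] [Finite G] (x : G) (p k : ℕ) (hp : p.Prime)
    (h : Nat.card {z | IsConj x z} = p ^ k) :
    IsSolvable (Subgroup.normalClosure ({x} : Set G)) ∧
      ∀ (H : Type*) [Group H] [Finite H], IsSimpleGroup H → (∃ a b : H, a * b ≠ b * a) →
        ∀ z : H, z ≠ 1 → ∀ q m : ℕ, q.Prime → Nat.card {w | IsConj z w} ≠ q ^ m := by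
  refine ⟨main_aux_s15 p hp _ G rfl x k (by rw [← card_conj, h]), ?_⟩
  intro H _ _ hH hab z hz q m hq hc
  have h1 := main_aux_s15 q hq _ H rfl z m (by rw [← card_conj, hc])
  have h2 : Subgroup.normalClosure {z} = ⊤ := by
    rcases (Subgroup.normalClosure_normal (s := {z})).eq_bot_or_eq_top with h2 | h2
    · exfalso
      apply hz
      have h3 : z ∈ Subgroup.normalClosure {z} := Subgroup.subset_normalClosure rfl
      rwa [h2, Subgroup.mem_bot] at h3
    · exact h2
  rw [h2] at h1
  have h4 : Group.IsSolvable H := Group.isSolvable_of_surjective (f := (⊤ : Subgroup H).subtype)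
    (fun a => ⟨⟨a, trivial⟩, rfl⟩)
  obtain ⟨a, b, hne⟩ := hab
  exact hne (IsSimpleGroup.comm_iff_isSolvable.2 h4 a b)
end

section
/- Let A be a solvable subgroup of a finite group G such that A lies in the center of every solvable subgroup of G that contains A. Then A lies in the center of G. -/
open Module

theorem sh_diag {V : Type*} [AddCommGroup V] [Module ℂ V] [FiniteDimensional ℂ V]
    (f : End ℂ V) {k : ℕ} (hk : k ≠ 0) (hf : f ^ k = 1) :
    ∃ (s : Finset V) (b : Basis s ℂ V) (μ : s → ℂ), (∀ i, f (b i) = μ i • b i) ∧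
      ∀ i, ‖μ i‖ = 1 := by
  classical
  have hss : f.IsSemisimple := by
    refine Module.End.isSemisimple_of_squarefree_aeval_eq_zero
      (p := (Polynomial.X ^ k - Polynomial.C 1 : Polynomial ℂ)) ?_ ?_
    · exact (Polynomial.separable_X_pow_sub_C 1 (by exact_mod_cast hk) one_ne_zero).squarefree
    · simp [hf]
  have htop := hss.iSup_eigenspace_eq_top
  let S : Set V := {v | ∃ μ : ℂ, f v = μ • v}
  have hS : ⊤ ≤ Submodule.span ℂ S := by
    rw [← htop]
    refine iSup_le fun μ v hv => Submodule.subset_span ⟨μ, ?_⟩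
    exact Module.End.mem_eigenspace_iff.1 hv
  let b := Basis.ofSpan hS
  have hb : ∀ i, ∃ μ : ℂ, f (b i) = μ • b i := fun i => Basis.ofSpan_subset hS ⟨i, rfl⟩
  have : Fintype _ := FiniteDimensional.fintypeBasisIndex b
  obtain ⟨t, ht⟩ := (Set.toFinite (Set.range b)).exists_finset_coe
  let b' : Basis t ℂ V := b.reindexRange.reindex (Equiv.setCongr ht.symm)
  have hb' : ∀ i, ∃ μ : ℂ, f (b' i) = μ • b' i := by
    intro i
    simp only [b', Basis.reindex_apply, Basis.reindexRange_apply]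
    obtain ⟨x, hx⟩ := i
    have : x ∈ Set.range b := ht ▸ hx
    obtain ⟨j, rfl⟩ := this
    exact hb j
  choose μ hμ using hb'
  refine ⟨t, b', μ, hμ, fun i => ?_⟩
  have hp : ∀ n : ℕ, (f ^ n) (b' i) = μ i ^ n • b' i := by
    intro n
    induction n with
    | zero => simp
    | succ n ih => rw [pow_succ', Module.End.mul_apply, ih, map_smul, hμ, smul_smul, pow_succ]
  have h1 := hp k
  rw [hf, Module.End.one_apply] at h1
  have h2 : μ i ^ k = 1 := by
    have : (μ i ^ k - 1) • b' i = 0 := by rw [sub_smul, one_smul, ← h1, sub_self]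
    rcases smul_eq_zero.1 this with h | h
    · exact sub_eq_zero.1 h
    · exact absurd h (b'.ne_zero i)
  exact Complex.norm_eq_one_of_pow_eq_one h2 hk

theorem sh_trace_diag {V : Type*} [AddCommGroup V] [Module ℂ V] 
    (f : End ℂ V) {s : Finset V} (b : Basis s ℂ V) (μ : s → ℂ) (h : ∀ i, f (b i) = μ i • b i) :
    LinearMap.trace ℂ V f = ∑ i, μ i := by
  classical
  rw [LinearMap.trace_eq_matrix_trace ℂ b, Matrix.trace]
  refine Finset.sum_congr rfl fun i _ => ?_
  simp [LinearMap.toMatrix_apply, h]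

theorem sh_trace_inv {V : Type*} [AddCommGroup V] [Module ℂ V] [FiniteDimensional ℂ V]
    (f g : End ℂ V) {k : ℕ} (hk : k ≠ 0) (hf : f ^ k = 1) (hg : g * f = 1) :
    LinearMap.trace ℂ V g = starRingEnd ℂ (LinearMap.trace ℂ V f) := by
  obtain ⟨s, b, μ, h, hn⟩ := sh_diag f hk hf
  have hne : ∀ i, μ i ≠ 0 := fun i hi => by simpa [hi] using hn i
  have : ∀ i, g (b i) = (μ i)⁻¹ • b i := by
    intro i
    have h1 : g (f (b i)) = b i := by rw [← Module.End.mul_apply, hg, Module.End.one_apply]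
    rw [h, map_smul] at h1
    rw [← h1, smul_smul, inv_mul_cancel₀ (hne i), one_smul, h1]
  rw [sh_trace_diag f b μ h, sh_trace_diag g b _ this, map_sum]
  refine Finset.sum_congr rfl fun i _ => ?_
  rw [Complex.inv_def, Complex.normSq_eq_norm_sq, hn]; simp

theorem sh_trace_one {V : Type*} [AddCommGroup V] [Module ℂ V] [FiniteDimensional ℂ V]
    (f : End ℂ V) {k : ℕ} (hk : k ≠ 0) (hf : f ^ k = 1)
    (ht : LinearMap.trace ℂ V f = finrank ℂ V) : f = 1 := by
  obtain ⟨s, b, μ, h, hn⟩ := sh_diag f hk hf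
  rw [sh_trace_diag f b μ h, finrank_eq_card_basis b] at ht
  have hle : ∀ i ∈ Finset.univ, (μ i).re ≤ (1 : ℝ) := fun i _ => (Complex.re_le_norm _).trans (hn i).le
  have hs : ∑ i, (μ i).re = ∑ i : s, (1 : ℝ) := by
    have := congrArg Complex.re ht
    simpa using this
  have he := (Finset.sum_eq_sum_iff_of_le hle).1 hs
  refine b.ext fun i => ?_
  have hre := he i (Finset.mem_univ _)
  have : μ i = 1 := by
    have h2 := hn i
    have h3 := Complex.sq_norm (μ i)
    rw [h2, Complex.normSq_apply, hre] at h3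
    apply Complex.ext
    · simpa using hre
    · simp; nlinarith
  rw [h, this]; simp

section
variable {G : Type*} [Group G] [Finite G] {V : Type*} [AddCommGroup V] [Module ℂ V]
  [FiniteDimensional ℂ V] (ρ : Representation ℂ G V)

theorem sh_char_inv (g : G) : ρ.character g⁻¹ = starRingEnd ℂ (ρ.character g) := by
  refine sh_trace_inv _ _ (k := Nat.card G) Nat.card_pos.ne' ?_ ?_
  · rw [← map_pow, pow_card_eq_one', map_one]
  · rw [← map_mul, inv_mul_cancel, map_one]

theorem sh_char_ker (g : G) (h : ρ.character g = finrank ℂ V) : ρ g = 1 := by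
  refine sh_trace_one _ (k := Nat.card G) Nat.card_pos.ne' ?_ h
  rw [← map_pow, pow_card_eq_one', map_one]

theorem sh_sum_char [Fintype G] : ∑ g : G, ρ.character g = Nat.card G * finrank ℂ ρ.invariants := by
  have h0 : (Nat.card G : ℂ) ≠ 0 := by exact_mod_cast Nat.card_pos.ne'
  have := invertibleOfNonzero h0
  rw [← ρ.card_inv_mul_sum_char_eq_finrank, mul_inv_cancel_left₀ h0]

theorem sh_sum_sq [Fintype G] : ∑ g : G, ‖ρ.character g‖ ^ 2 =
    Nat.card G * finrank ℂ (Representation.IntertwiningMap ρ ρ) := by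
  have h0 : (Nat.card G : ℂ) ≠ 0 := by exact_mod_cast Nat.card_pos.ne'
  have := invertibleOfNonzero h0
  have h := ρ.card_inv_mul_sum_char_mul_char_eq_finrank ρ
  rw [inv_mul_eq_iff_eq_mul₀ h0] at h
  simp_rw [sh_char_inv, Complex.mul_conj, Complex.normSq_eq_norm_sq] at h
  exact_mod_cast h

omit [Finite G] in
theorem sh_char_compl (W W' : Subrepresentation ρ) (h : IsCompl W W') (g : G) :
    ρ.character g = W.toRepresentation.character g + W'.toRepresentation.character g := by
  have hc : IsCompl W.toSubmodule W'.toSubmodule := by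
    constructor
    · rw [disjoint_iff, ← Subrepresentation.toSubmodule_inf, h.inf_eq_bot]; rfl
    · rw [codisjoint_iff, ← Subrepresentation.toSubmodule_sup, h.sup_eq_top]; rfl
  let e := Submodule.prodEquivOfIsCompl _ _ hc
  unfold Representation.character
  rw [← LinearMap.trace_prodMap', ← LinearMap.trace_conj' _ e]
  congr 1
  ext v
  obtain ⟨⟨a, b⟩, rfl⟩ := e.surjective v
  simp [LinearEquiv.conj_apply, e, Subrepresentation.toRepresentation]
end

theorem sh_char_reg {G : Type*} [Group G] [Finite G] (g : G) (hg : g ≠ 1) :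
    (Representation.ofMulAction ℂ G G).character g = 0 := by
  classical
  have := Fintype.ofFinite G
  unfold Representation.character
  rw [LinearMap.trace_eq_matrix_trace ℂ (Basis.ofRepr (MonoidAlgebra.coeffLinearEquiv ℂ)), Matrix.trace]
  refine Finset.sum_eq_zero fun i _ => ?_
  simp [LinearMap.toMatrix_apply, hg]
open Classical in
theorem sh_count {G : Type*} [Group G] [Fintype G] (M : Subgroup G)
    (hTI : ∀ g r : G, r ∈ M → r ≠ 1 → g⁻¹ * r * g ∈ M → g ∈ M) {R : Type*} [Field R]
    (f : G → R) (hf : ∀ g x, f (x * g * x⁻¹) = f g) :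
    (Nat.card M : R) * (∑ g, f g - ∑ g with (∀ x : G, x⁻¹ * g * x ∈ M → g = 1), f g) =
      Nat.card G * (∑ m : M, f m - f 1) := by
  have h1 : ∀ x : G, (∑ g : G, if x⁻¹ * g * x ∈ M ∧ g ≠ 1 then f g else 0) =
      ∑ m : M, f m - f 1 := by
    intro x
    have : (∑ g : G, if x⁻¹ * g * x ∈ M ∧ g ≠ 1 then f g else 0) =
        ∑ g : G, if g ∈ M ∧ g ≠ 1 then f g else 0 := by
      refine (Fintype.sum_equiv (MulAut.conj x).toEquiv _ _ fun g => ?_).symm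
      have e : x⁻¹ * (x * g * x⁻¹) * x = g := by group
      simp [e, hf]
    rw [this]
    have h2 : ∑ m : M, f m = ∑ g : G, if g ∈ M then f g else 0 := by
      rw [← Finset.sum_filter]
      exact (Finset.sum_subtype _ (by simp) f).symm
    have h3 : f 1 = ∑ g : G, if g = 1 then f g else 0 := by simp
    rw [h2, h3, ← Finset.sum_sub_distrib]
    refine Finset.sum_congr rfl fun g _ => ?_
    by_cases hg : g = 1
    · simp [hg, M.one_mem]
    · simp [hg]
  have h4 : ∑ x : G, (∑ g : G, if x⁻¹ * g * x ∈ M ∧ g ≠ 1 then f g else 0) =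
      Nat.card G * (∑ m : M, f m - f 1) := by
    simp [h1, mul_sub]
  rw [← h4, Finset.sum_comm, Finset.sum_filter, ← Finset.sum_sub_distrib, Finset.mul_sum]
  refine Finset.sum_congr rfl fun g _ => ?_
  by_cases hg : ∀ x : G, x⁻¹ * g * x ∈ M → g = 1
  · rw [if_pos hg, sub_self, mul_zero, eq_comm]
    refine Finset.sum_eq_zero fun x _ => ?_
    rw [if_neg]
    rintro ⟨h, h'⟩
    exact h' (hg x h)
  · rw [if_neg hg, sub_zero]
    push Not at hg
    obtain ⟨y, hy, hg1⟩ := hg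
    have h5 : ∀ x, (x⁻¹ * g * x ∈ M ∧ g ≠ 1) ↔ y⁻¹ * x ∈ M := by
      intro x
      constructor
      · rintro ⟨h, -⟩
        refine hTI _ _ hy ?_ ?_
        · intro h
          apply hg1
          have : g = y * (y⁻¹ * g * y) * y⁻¹ := by group
          rw [this, h]; group
        · convert h using 1; group
      · intro h
        refine ⟨?_, hg1⟩
        have := M.mul_mem (M.mul_mem (M.inv_mem h) hy) h
        convert this using 1; group
    simp_rw [h5]
    rw [← Finset.sum_filter, Finset.sum_const, nsmul_eq_mul]
    congr 2
    rw [Nat.card_eq_fintype_card, Fintype.card_subtype]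
    refine Finset.card_bij (fun m _ => y * m) ?_ ?_ ?_
    · simp
    · simp
    · intro b hb
      exact ⟨y⁻¹ * b, by simpa using hb, by simp⟩

open Classical in
theorem sh_dich {G : Type*} [Group G] [Fintype G] (M : Subgroup G)
    (hTI : ∀ g r : G, r ∈ M → r ≠ 1 → g⁻¹ * r * g ∈ M → g ∈ M)
    (χ : G → ℂ) (hχ : ∀ g x, χ (x * g * x⁻¹) = χ g) (d m1 s : ℕ) (hd : χ 1 = d)
    (hG1 : ∑ g, χ g = 0) (hG2 : ∑ g, ‖χ g‖ ^ 2 = Nat.card G)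
    (hM1 : ∑ m : M, χ m = Nat.card M * m1) (hM2 : ∑ m : M, ‖χ m‖ ^ 2 = Nat.card M * s) :
    (∀ m ∈ M, m ≠ 1 → χ m = 0) ∨ ∀ g, (∀ x : G, x⁻¹ * g * x ∈ M → g = 1) → χ g = d := by
  set K : Finset G := Finset.univ.filter (fun g => ∀ x : G, x⁻¹ * g * x ∈ M → g = 1) with hK
  have hMpos : (0 : ℝ) < Nat.card M := by exact_mod_cast Nat.card_pos
  set M0 : ℝ := ((Nat.card M : ℕ) : ℝ) with hM0
  set k0 : ℝ := ((K.card : ℕ) : ℝ) with hk0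
  have hkpos : 0 < k0 := by
    rw [hk0]
    have : (1 : G) ∈ K := by simp [hK]
    exact_mod_cast Finset.card_pos.2 ⟨_, this⟩
  have c0 := sh_count M hTI (R := ℝ) (fun _ => 1) (fun _ _ => rfl)
  have c1 := sh_count M hTI (R := ℝ) (fun g => (χ g).re) (fun g x => by simp only [hχ])
  have c2 := sh_count M hTI (R := ℝ) (fun g => ‖χ g‖ ^ 2) (fun g x => by simp only [hχ])
  have hM1' : ∑ m : M, (χ m).re = M0 * m1 := by
    have := congrArg Complex.re hM1
    rw [Complex.re_sum] at this
    rw [this, hM0]; norm_cast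
  have hG1' : ∑ g, (χ g).re = 0 := by
    have := congrArg Complex.re hG1
    rwa [Complex.re_sum] at this
  rw [← hK] at c0 c1 c2
  rw [hG1', hM1', hd] at c1
  rw [hG2, hM2, hd] at c2
  simp only [Finset.sum_const, nsmul_eq_mul, mul_one, Finset.card_univ, 
    ← Nat.card_eq_fintype_card, Complex.natCast_re, Complex.norm_natCast] at c0 c1 c2
  rw [← hM0, ← hk0] at c0
  rw [← hM0] at c1 c2
  set g0 : ℝ := ((Nat.card G : ℕ) : ℝ)
  have hg0 : g0 = M0 * k0 := by linarith
  set S1 := ∑ g ∈ K, (χ g).re with hS1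
  set S2 := ∑ g ∈ K, ‖χ g‖ ^ 2 with hS2
  have e1 : S1 = k0 * (d - M0 * m1) := by
    apply mul_left_cancel₀ hMpos.ne'
    rw [hg0] at c1; linarith
  have e2 : S2 = k0 * (M0 - M0 * s + d ^ 2) := by
    apply mul_left_cancel₀ hMpos.ne'
    rw [hg0] at c2; linarith
  set c : ℝ := d - M0 * m1 with hc
  have hn : ∀ (z : ℂ) (a : ℝ), ‖z - a‖ ^ 2 = ‖z‖ ^ 2 - 2 * a * z.re + a ^ 2 := by
    intro z a
    rw [Complex.sq_norm, Complex.sq_norm, Complex.normSq_apply, Complex.normSq_apply]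
    simp; ring
  have q1 : ∑ g ∈ K, ‖χ g - (c : ℂ)‖ ^ 2 = k0 * M0 * (1 - (s - 2 * d * m1 + m1 ^ 2 * M0)) := by
    simp_rw [hn]
    rw [Finset.sum_add_distrib, Finset.sum_sub_distrib, ← Finset.mul_sum, ← hS1, ← hS2, e1, e2]
    simp only [Finset.sum_const, nsmul_eq_mul]
    rw [← hk0, hc]; ring
  have q2 : ∑ m : M, ‖χ m - ((if m = 1 then M0 * m1 else 0 : ℝ) : ℂ)‖ ^ 2 =
      M0 * (s - 2 * d * m1 + m1 ^ 2 * M0) := by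
    simp_rw [hn]
    rw [Finset.sum_add_distrib, Finset.sum_sub_distrib, hM2]
    simp [hd]; ring
  have n1 : 0 ≤ ∑ g ∈ K, ‖χ g - (c : ℂ)‖ ^ 2 := Finset.sum_nonneg fun _ _ => by positivity
  have n2 : 0 ≤ ∑ m : M, ‖χ m - ((if m = 1 then M0 * m1 else 0 : ℝ) : ℂ)‖ ^ 2 :=
    Finset.sum_nonneg fun _ _ => by positivity
  obtain ⟨t, ht⟩ : ∃ t : ℤ, (t : ℝ) = s - 2 * d * m1 + m1 ^ 2 * M0 :=
    ⟨s - 2 * d * m1 + m1 ^ 2 * (Nat.card M), by rw [hM0]; push_cast; ring⟩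
  rw [← ht] at q1 q2
  rw [q1] at n1
  rw [q2] at n2
  have t1 : t ≤ 1 := by
    have : (0 : ℝ) ≤ 1 - t := nonneg_of_mul_nonneg_right n1 (by positivity)
    have : (t : ℝ) ≤ 1 := by linarith
    exact_mod_cast this
  have t0 : 0 ≤ t := by
    have : (0 : ℝ) ≤ t := nonneg_of_mul_nonneg_right n2 (by positivity)
    exact_mod_cast this
  obtain rfl | rfl : t = 0 ∨ t = 1 := by omega
  · left
    intro m hm hm1
    rw [Int.cast_zero, mul_zero, Finset.sum_eq_zero_iff_of_nonneg fun _ _ => by positivity] at q2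
    have := q2 ⟨m, hm⟩ (Finset.mem_univ _)
    simpa [hm1] using this
  · right
    rw [Int.cast_one, sub_self, mul_zero, Finset.sum_eq_zero_iff_of_nonneg fun _ _ => by positivity] at q1
    have q3 : ∀ g ∈ K, χ g = c := fun g hg => by
      have := q1 g hg
      rwa [sq_eq_zero_iff, norm_eq_zero, sub_eq_zero] at this
    intro g hg
    rw [q3 g (by simpa [hK] using hg), ← q3 1 (by simp [hK]), hd]

universe u

open Classical in
theorem sh_frob_irr {G : Type u} [Group G] [Fintype G] (M : Subgroup G)
    (hTI : ∀ g r : G, r ∈ M → r ≠ 1 → g⁻¹ * r * g ∈ M → g ∈ M)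
    (N : Subgroup G) (hN : N = Subgroup.normalClosure {g | ∀ x : G, x⁻¹ * g * x ∈ M → g = 1})
    (m : G) (hmM : m ∈ M) (hmN : m ∈ N) (hm1 : m ≠ 1)
    {V : Type u} [AddCommGroup V] [Module ℂ V] [FiniteDimensional ℂ V]
    (ρ : Representation ℂ G V) (hirr : ρ.IsIrreducible) :
    (Nat.card N : ℂ) * ρ.character m = ∑ x : N, ρ.character x := by
  have hNn : N.Normal := hN ▸ Subgroup.normalClosure_normal
  by_cases htriv : ∀ x ∈ N, ρ x = 1
  · have hx : ∀ x ∈ N, ρ.character x = finrank ℂ V := fun x hx => by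
      rw [Representation.character, htriv x hx, LinearMap.trace_one]
    rw [hx m hmN, Finset.sum_congr rfl fun (x : N) _ => hx x x.2]
    simp
  have hinvN : Representation.invariants (ρ.comp N.subtype) = ⊥ := by
    let W : Subrepresentation ρ := ⟨Representation.invariants (ρ.comp N.subtype), by
      intro g v hv x
      have h1 := hv ⟨g⁻¹ * x * g, by simpa using hNn.conj_mem x x.2 g⁻¹⟩
      simp only [MonoidHom.coe_comp, Function.comp_apply, Subgroup.coe_subtype] at h1 ⊢
      have h2 := congrArg (ρ g) h1
      rw [← Module.End.mul_apply, ← map_mul] at h2 ⊢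
      rw [← h2]
      congr 2
      group⟩
    rcases eq_bot_or_eq_top W with h | h
    · exact congrArg Subrepresentation.toSubmodule h
    · exfalso
      apply htriv
      intro x hx
      ext v
      have hv : v ∈ W := by rw [h]; trivial
      exact hv ⟨x, hx⟩
  have hinvG : Representation.invariants ρ = ⊥ := by
    rw [eq_bot_iff, ← hinvN]
    intro v hv x
    exact hv x
  have hsum := sh_sum_char (ρ.comp N.subtype)
  rw [hinvN, finrank_bot, Nat.cast_zero, mul_zero] at hsum
  have hsum' : ∑ x : N, ρ.character x = 0 := hsum
  rw [hsum']
  have hG1 := sh_sum_char ρ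
  rw [hinvG, finrank_bot, Nat.cast_zero, mul_zero] at hG1
  have hG2 := sh_sum_sq ρ
  rw [Representation.IsIrreducible.finrank_intertwiningMap_self, Nat.cast_one, mul_one] at hG2
  rcases sh_dich M hTI ρ.character (fun g x => ρ.char_conj g x) _ _ _ ρ.char_one hG1 hG2
    (sh_sum_char (ρ.comp M.subtype)) (sh_sum_sq (ρ.comp M.subtype)) with h | h
  · rw [h m hmM hm1, mul_zero]
  · exfalso
    apply htriv
    have : N ≤ MonoidHom.ker (Representation.asGroupHom ρ) := by
      rw [hN]
      refine Subgroup.normalClosure_le_normal fun g hg => ?_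
      have := sh_char_ker ρ g (h g hg)
      simp only [SetLike.mem_coe, MonoidHom.mem_ker]
      ext1
      rw [Representation.asGroupHom_apply, this]; rfl
    intro x hx
    have h2 := this hx
    rw [MonoidHom.mem_ker] at h2
    rw [← Representation.asGroupHom_apply, h2]; rfl

open Classical in
theorem sh_frob_all {G : Type u} [Group G] [Fintype G] (M : Subgroup G)
    (hTI : ∀ g r : G, r ∈ M → r ≠ 1 → g⁻¹ * r * g ∈ M → g ∈ M)
    (N : Subgroup G) (hN : N = Subgroup.normalClosure {g | ∀ x : G, x⁻¹ * g * x ∈ M → g = 1})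
    (m : G) (hmM : m ∈ M) (hmN : m ∈ N) (hm1 : m ≠ 1) (n : ℕ) :
    ∀ (V : Type u) [AddCommGroup V] [Module ℂ V] [FiniteDimensional ℂ V]
    (ρ : Representation ℂ G V), finrank ℂ V = n →
    (Nat.card N : ℂ) * ρ.character m = ∑ x : N, ρ.character x := by
  induction n using Nat.strong_induction_on with
  | _ n ih =>
  intro V _ _ _ ρ hn
  by_cases hirr : ρ.IsIrreducible
  · exact sh_frob_irr M hTI N hN m hmM hmN hm1 ρ hirr
  rcases subsingleton_or_nontrivial V with hV | hV
  · have : ∀ g, ρ.character g = 0 := fun g => by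
      rw [Representation.character, Subsingleton.elim (ρ g) 0, map_zero]
    simp [this]
  have : ∃ W : Subrepresentation ρ, W ≠ ⊥ ∧ W ≠ ⊤ := by
    by_contra hcon
    push Not at hcon
    apply hirr
    have : Nontrivial (Subrepresentation ρ) := by
      refine ⟨⊥, ⊤, fun h => ?_⟩
      obtain ⟨v, hv⟩ := exists_ne (0 : V)
      have : v ∈ (⊥ : Subrepresentation ρ) := by rw [h]; trivial
      exact hv this
    exact ⟨fun W => or_iff_not_imp_left.2 (hcon W)⟩
  obtain ⟨W, hb, ht⟩ := this
  have : NeZero (Nat.card G : ℂ) := ⟨by exact_mod_cast Nat.card_pos.ne'⟩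
  obtain ⟨W', hW⟩ := exists_isCompl W
  have ht' : W' ≠ ⊤ := fun h => hb (by simpa [h] using hW.inf_eq_bot)
  have hlt : ∀ U : Subrepresentation ρ, U ≠ ⊤ → finrank ℂ U.toSubmodule < n := by
    intro U hU
    rw [← hn]
    apply Submodule.finrank_lt
    intro h
    exact hU (Subrepresentation.toSubmodule_injective h)
  simp_rw [sh_char_compl ρ W W' hW]
  rw [mul_add, Finset.sum_add_distrib, ih _ (hlt W ht) _ _ rfl, ih _ (hlt W' ht') _ _ rfl]

theorem sh_frob {G : Type u} [Group G] [Finite G] (M : Subgroup G)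
    (hTI : ∀ g r : G, r ∈ M → r ≠ 1 → g⁻¹ * r * g ∈ M → g ∈ M)
    (m : G) (hmM : m ∈ M)
    (hmN : m ∈ Subgroup.normalClosure {g | ∀ x : G, x⁻¹ * g * x ∈ M → g = 1}) : m = 1 := by
  classical
  have := Fintype.ofFinite G
  by_contra hm1
  have h := sh_frob_all M hTI _ rfl m hmM hmN hm1 _ _ (Representation.ofMulAction ℂ G G) rfl
  rw [sh_char_reg m hm1, mul_zero, Finset.sum_eq_single 1] at h
  · have h2 := Representation.char_one (Representation.ofMulAction ℂ G G)
    rw [Subgroup.coe_one, h2] at h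
    have h3 : finrank ℂ (MonoidAlgebra ℂ G) = 0 := by exact_mod_cast h.symm
    rw [(MonoidAlgebra.coeffLinearEquiv ℂ).finrank_eq] at h3
    simp at h3
  · intro b _ hb
    exact sh_char_reg _ (by simpa using hb)
  · simp

theorem sh_comap_solv {G : Type*} [Group G] (N : Subgroup G) [N.Normal] (hN : Group.IsSolvable N)
    (S : Subgroup (G ⧸ N)) (hS : Group.IsSolvable S) :
    Group.IsSolvable (S.comap (QuotientGroup.mk' N)) := by
  have := hN
  have := hS
  have hle : N ≤ S.comap (QuotientGroup.mk' N) := by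
    intro x hx
    rw [Subgroup.mem_comap, QuotientGroup.mk'_apply, (QuotientGroup.eq_one_iff x).2 hx]
    exact S.one_mem
  refine Group.isSolvable_of_ker_le_range (Subgroup.inclusion hle)
    ((QuotientGroup.mk' N).subgroupComap S) ?_
  rintro ⟨x, hx⟩ hk
  rw [MonoidHom.mem_ker] at hk
  have h2 : (QuotientGroup.mk' N) x = 1 := congrArg Subtype.val hk
  exact ⟨⟨x, (QuotientGroup.eq_one_iff x).1 h2⟩, rfl⟩

theorem sh_TI {G : Type u} [Group G] [Finite G] (A M : Subgroup G)
    (hMc : ∀ x, x ∈ M ↔ ∀ a ∈ A, a * x = x * a) (hMt : M ≠ ⊤) (hAM : A ≤ M)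
    (hmax : ∀ H : Subgroup G, A ≤ H → H ≠ ⊤ → H ≤ M)
    (hns : ∀ N : Subgroup G, N.Normal → Group.IsSolvable N → N = ⊥) :
    ∀ g r : G, r ∈ M → r ≠ 1 → g⁻¹ * r * g ∈ M → g ∈ M := by
  have hA1 : A ≠ ⊥ := by
    rintro rfl
    apply hMt
    rw [Subgroup.eq_top_iff']
    intro x
    rw [hMc]
    simp
  have hCr : ∀ r ∈ M, r ≠ 1 → ∀ y, y * r = r * y → y ∈ M := by
    intro r hr hr1 y hy
    refine hmax (Subgroup.centralizer {r}) ?_ ?_ ?_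
    · intro a ha
      rw [Subgroup.mem_centralizer_singleton_iff]
      exact (hMc r).1 hr a ha
    · intro htop
      apply hr1
      have hz : r ∈ Subgroup.center G := by
        rw [Subgroup.mem_center_iff]
        intro g
        have : g ∈ Subgroup.centralizer {r} := by rw [htop]; trivial
        rw [Subgroup.mem_centralizer_singleton_iff] at this
        exact this
      have := hns (Subgroup.center G) inferInstance
        (Group.isSolvable_of_comm fun x y => mul_comm' x y)
      rwa [this, Subgroup.mem_bot] at hz
    · rw [Subgroup.mem_centralizer_singleton_iff]
      exact hy
  intro g r hr hr1 hgr
  -- conjugates of A lie in M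
  have h1 : ∀ a ∈ A, g * a * g⁻¹ ∈ M := by
    intro a ha
    apply hCr r hr hr1
    have := (hMc _).1 hgr a ha
    calc g * a * g⁻¹ * r = g * (a * (g⁻¹ * r * g)) * g⁻¹ := by group
      _ = g * ((g⁻¹ * r * g) * a) * g⁻¹ := by rw [this]
      _ = _ := by group
  have h2 : A ≤ M.map (MulAut.conj g).toMonoidHom := by
    intro a ha
    refine ⟨g⁻¹ * a * g, ?_, by simp; group⟩
    rw [SetLike.mem_coe, hMc]
    intro b hb
    have := (hMc _).1 (h1 b hb) a ha
    calc b * (g⁻¹ * a * g) = g⁻¹ * ((g * b * g⁻¹) * a) * g := by group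
      _ = g⁻¹ * (a * (g * b * g⁻¹)) * g := by rw [this]
      _ = _ := by group
  have hcard : Nat.card (M.map (MulAut.conj g).toMonoidHom) = Nat.card M :=
    Subgroup.card_map_of_injective (MulAut.conj g).injective
  have h3 : M.map (MulAut.conj g).toMonoidHom ≤ M := by
    apply hmax _ h2
    intro ht
    apply hMt
    apply Subgroup.eq_top_of_card_eq
    rw [← hcard, ht, Subgroup.card_top]
  have h4 : M.map (MulAut.conj g).toMonoidHom = M := Subgroup.eq_of_le_of_card_ge h3 hcard.ge
  have hgN : g ∈ Subgroup.normalizer (M : Set G) := by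
    rw [Subgroup.mem_normalizer_iff]
    intro h
    constructor
    · intro hh
      exact h3 ⟨h, hh, rfl⟩
    · intro hh
      rw [← h4] at hh
      obtain ⟨y, hy, hy2⟩ := hh
      have : y = h := (MulAut.conj g).injective hy2
      exact this ▸ hy
  refine hmax _ (hAM.trans Subgroup.le_normalizer) ?_ hgN
  intro ht
  have hMn : M.Normal := Subgroup.normalizer_eq_top_iff.1 ht
  have hA2 : A ≤ Subgroup.centralizer (M : Set G) := by
    intro a ha
    rw [Subgroup.mem_centralizer_iff]
    intro m hm
    exact ((hMc m).1 hm a ha).symm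
  have hc := hns (Subgroup.centralizer (M : Set G)) inferInstance (by
    refine Group.isSolvable_of_comm fun x y => Subtype.ext ?_
    have hx : (x : G) ∈ M := by
      rw [hMc]
      intro a ha
      exact Subgroup.mem_centralizer_iff.1 x.2 a (hAM ha)
    exact Subgroup.mem_centralizer_iff.1 y.2 x hx)
  rw [hc, le_bot_iff] at hA2
  exact hA1 hA2

theorem sh_coprime {G : Type u} [Group G] [Finite G] (M : Subgroup G)
    (hTI : ∀ g r : G, r ∈ M → r ≠ 1 → g⁻¹ * r * g ∈ M → g ∈ M) :
    Nat.Coprime M.index (Nat.card M) := by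
  refine Nat.Coprime.symm (Nat.coprime_of_dvd fun q hq hqM hqi => ?_)
  have := Fact.mk hq
  obtain ⟨r, hr⟩ := exists_prime_orderOf_dvd_card' q hqM
  have hP : IsPGroup q (Subgroup.zpowers (r : G)) := by
    apply IsPGroup.of_card (n := 1)
    rw [Nat.card_zpowers, Subgroup.orderOf_coe, hr, pow_one]
  have hr1 : (r : G) ≠ 1 := by
    intro h
    rw [← Subgroup.orderOf_coe, h, orderOf_one] at hr
    exact hq.one_lt.ne hr
  have hm := hP.card_modEq_card_fixedPoints (G ⧸ M)
  have hf : MulAction.fixedPoints (Subgroup.zpowers (r : G)) (G ⧸ M) = {((1 : G) : G ⧸ M)} := by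
    ext x
    obtain ⟨g, rfl⟩ := QuotientGroup.mk_surjective x
    rw [MulAction.mem_fixedPoints, Set.mem_singleton_iff]
    constructor
    · intro h
      have h1 := h ⟨r, Subgroup.mem_zpowers _⟩
      have h2 : ((r * g : G) : G ⧸ M) = (g : G ⧸ M) := h1
      rw [eq_comm, QuotientGroup.eq, ← mul_assoc] at h2
      have h3 := hTI g r r.2 hr1 h2
      rw [eq_comm, QuotientGroup.eq]
      simpa using h3
    · intro h
      rw [h]
      rintro ⟨y, hy⟩
      have hyM : y ∈ M := (Subgroup.zpowers_le.2 r.2) hy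
      change ((y * 1 : G) : G ⧸ M) = _
      rw [eq_comm, QuotientGroup.eq]
      simpa using hyM
  rw [hf] at hm
  rw [Nat.card_coe_set_eq, Set.ncard_singleton] at hm
  change M.index ≡ 1 [MOD q] at hm
  have h0 : M.index ≡ 0 [MOD q] := (Nat.modEq_zero_iff_dvd).2 hqi
  have := hm.symm.trans h0
  rw [Nat.modEq_zero_iff_dvd] at this
  exact hq.one_lt.ne' (Nat.dvd_one.1 this)

theorem sh_core {G : Type u} [Group G] [Finite G] (A M : Subgroup G)
    (hMc : ∀ x, x ∈ M ↔ ∀ a ∈ A, a * x = x * a) (hMt : M ≠ ⊤) (hAM : A ≤ M)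
    (hmax : ∀ H : Subgroup G, A ≤ H → H ≠ ⊤ → H ≤ M)
    (hns : ∀ N : Subgroup G, N.Normal → Group.IsSolvable N → N = ⊥) : False := by
  classical
  have hTI := sh_TI A M hMc hMt hAM hmax hns
  have hA1 : A ≠ ⊥ := by
    rintro rfl
    apply hMt
    rw [Subgroup.eq_top_iff']
    intro x
    rw [hMc]
    simp
  have hcop := sh_coprime M hTI
  have hfrob := sh_frob M hTI
  have hKN : ∀ g, (∀ x : G, x⁻¹ * g * x ∈ M → g = 1) →
      g ∈ Subgroup.normalClosure {g | ∀ x : G, x⁻¹ * g * x ∈ M → g = 1} :=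
    fun g hg => Subgroup.subset_normalClosure hg
  have hNn : (Subgroup.normalClosure {g | ∀ x : G, x⁻¹ * g * x ∈ M → g = 1}).Normal :=
    Subgroup.normalClosure_normal
  generalize Subgroup.normalClosure {g | ∀ x : G, x⁻¹ * g * x ∈ M → g = 1} = N at *
  have hN1 : N ≠ ⊥ := by
    rintro rfl
    apply hMt
    have := Fintype.ofFinite G
    have h := sh_count M hTI (R := ℚ) (fun _ => 1) (fun _ _ => rfl)
    have hK : (Finset.univ.filter fun g : G => ∀ x : G, x⁻¹ * g * x ∈ M → g = 1) = {1} := by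
      ext g
      simp only [Finset.mem_filter, Finset.mem_univ, true_and, Finset.mem_singleton]
      constructor
      · intro hg
        simpa using hKN g hg
      · rintro rfl
        simp
    rw [hK] at h
    simp only [Finset.sum_const, nsmul_eq_mul, mul_one, Finset.card_univ,
      ← Nat.card_eq_fintype_card, Finset.card_singleton, Nat.cast_one] at h
    apply Subgroup.eq_top_of_card_eq
    have : (Nat.card M : ℚ) = Nat.card G := by linarith
    exact_mod_cast this
  have hNA : N ⊔ A = ⊤ := by
    by_contra hne
    have := hmax _ le_sup_right hne
    apply hN1
    rw [eq_bot_iff]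
    intro x hx
    exact hfrob x (this (Subgroup.mem_sup_left hx)) hx
  have hdec : ∀ g, ∃ x ∈ N, ∃ a ∈ A, x * a = g := by
    intro g
    have : g ∈ N ⊔ A := by rw [hNA]; trivial
    exact Subgroup.mem_sup_of_normal_left.1 this
  have hcompl : Subgroup.IsComplement' N M := by
    apply Subgroup.isComplement'_of_disjoint_and_mul_eq_univ
    · rw [Subgroup.disjoint_def]
      intro x h1 h2
      exact hfrob x h2 h1
    · rw [Set.eq_univ_iff_forall]
      intro g
      obtain ⟨x, hx, a, ha, rfl⟩ := hdec g
      exact ⟨x, hx, a, hAM ha, rfl⟩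
  have hcN : M.index = Nat.card N := hcompl.index_eq_card
  have hcM : N.index = Nat.card M := hcompl.symm.index_eq_card
  rw [hcN] at hcop
  have hcomm : ∀ g h : G, (h * g)⁻¹ * (g * h) ∈ N := by
    intro g h
    obtain ⟨x, hx, a, ha, rfl⟩ := hdec g
    obtain ⟨y, hy, b, hb, rfl⟩ := hdec h
    rw [← QuotientGroup.eq]
    have h1 : (x : G ⧸ N) = 1 := (QuotientGroup.eq_one_iff x).2 hx
    have h2 : (y : G ⧸ N) = 1 := (QuotientGroup.eq_one_iff y).2 hy
    have h3 : (b * a : G) = a * b := (hMc a).1 (hAM ha) b hb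
    simp only [QuotientGroup.mk_mul, h1, h2, one_mul]
    rw [← QuotientGroup.mk_mul, h3, QuotientGroup.mk_mul]
  -- Sylow subgroup
  have hcN1 : Nat.card N ≠ 1 := fun h => hN1 (Subgroup.card_eq_one.1 h)
  obtain ⟨q, hq, hqN⟩ := Nat.exists_prime_and_dvd hcN1
  have := Fact.mk hq
  obtain ⟨P⟩ : Nonempty (Sylow q N) := inferInstance
  have hfr := Sylow.normalizer_sup_eq_top P
  have hPN : (P : Subgroup N).map N.subtype ≤ N := Subgroup.map_subtype_le _
  have hP1 : (P : Subgroup N).map N.subtype ≠ ⊥ := by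
    intro h
    rw [Subgroup.map_eq_bot_iff_of_injective _ N.subtype_injective] at h
    exact P.ne_bot_of_dvd_card hqN h
  have hPs : Group.IsSolvable ((P : Subgroup N).map N.subtype) := by
    have : Group.IsNilpotent ((P : Subgroup N).map N.subtype) :=
      (P.isPGroup'.map N.subtype).isNilpotent
    infer_instance
  generalize (P : Subgroup N).map N.subtype = Q at *
  have hLt : Subgroup.normalizer (Q : Set G) ≠ ⊤ := by
    intro h
    exact hP1 (hns Q (Subgroup.normalizer_eq_top_iff.1 h) hPs)
  have hQL : Q ≤ Subgroup.normalizer (Q : Set G) := Subgroup.le_normalizer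
  generalize Subgroup.normalizer (Q : Set G) = L at *
  have hidx : (N.subgroupOf L).index = Nat.card M := by
    rw [← hcM]
    change N.relIndex L = _
    rw [← Subgroup.relIndex_sup_right, hfr, Subgroup.relIndex_top_right]
  have hcop2 : Nat.Coprime (Nat.card (N.subgroupOf L)) (N.subgroupOf L).index := by
    rw [hidx]
    refine Nat.Coprime.coprime_dvd_left ?_ hcop
    have : Nat.card (N.subgroupOf L) = Nat.card (N ⊓ L : Subgroup G) := by
      rw [← Subgroup.subgroupOf_map_subtype]
      exact (Subgroup.card_map_of_injective L.subtype_injective).symm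
    rw [this]
    exact Subgroup.card_dvd_of_le inf_le_left
  obtain ⟨B, hB⟩ := Subgroup.exists_right_complement'_of_coprime hcop2
  have hBc : Nat.card B = Nat.card M := by rw [← hidx, hB.symm.index_eq_card]
  have hB1 : B ≠ ⊥ := by
    rintro rfl
    rw [Subgroup.card_bot, eq_comm, Subgroup.card_eq_one] at hBc
    exact hA1 (le_bot_iff.1 (hBc ▸ hAM))
  have hBN : ∀ b ∈ B, (b : G) ∈ N → b = 1 := by
    intro b hb hbN
    exact Subgroup.disjoint_def.1 hB.disjoint (x := b) (Subgroup.mem_subgroupOf.2 hbN) hb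
  have hBcomm : ∀ b ∈ B, ∀ c ∈ B, b * c = c * b := by
    intro b hb c hc
    have := hBN ((c * b)⁻¹ * (b * c)) (B.mul_mem (B.inv_mem (B.mul_mem hc hb)) (B.mul_mem hb hc))
      (hcomm b c)
    exact (inv_mul_eq_one.1 this).symm
  obtain ⟨b, hb, hb1⟩ := (Subgroup.ne_bot_iff_exists_ne_one.1 hB1 |> fun ⟨b, hb⟩ =>
    (⟨b.1, b.2, fun h => hb (Subtype.ext h)⟩ : ∃ b : L, b ∈ B ∧ b ≠ 1))
  have : ∃ x : G, x⁻¹ * b * x ∈ M := by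
    by_contra hcon
    push Not at hcon
    exact hb1 (hBN b hb (hKN b fun x hx => absurd hx (hcon x)))
  obtain ⟨x, hx⟩ := this
  have hbG : (b : G) ≠ 1 := fun h => hb1 (Subtype.ext h)
  let f : L →* G := (MulAut.conj x⁻¹).toMonoidHom.comp L.subtype
  have hf : Function.Injective f := (MulAut.conj x⁻¹).injective.comp L.subtype_injective
  have hfa : ∀ y : L, f y = x⁻¹ * y * x := fun y => by simp [f]
  have hBM : B.map f ≤ M := by
    rintro _ ⟨c, hc, rfl⟩
    rw [hfa]
    refine hTI _ _ hx ?_ ?_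
    · intro h
      apply hbG
      have : (b : G) = x * (x⁻¹ * b * x) * x⁻¹ := by group
      rw [this, h]; group
    · have hbc : (b : G) * c = c * b := congrArg Subtype.val (hBcomm b hb c hc)
      convert hx using 1
      calc (x⁻¹ * (c : G) * x)⁻¹ * (x⁻¹ * b * x) * (x⁻¹ * c * x)
          = x⁻¹ * (c : G)⁻¹ * (b * c) * x := by group
        _ = _ := by rw [hbc]; group
  have hBM' : B.map f = M := by
    apply Subgroup.eq_of_le_of_card_ge hBM
    rw [Subgroup.card_map_of_injective hf, hBc]
  have hH : f.range ≤ M := by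
    apply hmax
    · refine hAM.trans ?_
      rw [← hBM']
      exact Subgroup.map_le_range _ _
    · intro ht
      apply hLt
      apply Subgroup.eq_top_of_card_eq
      rw [← Subgroup.card_top (G := G), ← ht]
      exact Nat.card_congr (MonoidHom.ofInjective hf).toEquiv
  apply hP1
  rw [eq_bot_iff]
  intro y hy
  have h1 : x⁻¹ * y * x ∈ M := hH ⟨⟨y, hQL hy⟩, hfa _⟩
  have h2 : x⁻¹ * y * x ∈ N := by simpa using hNn.conj_mem y (hPN hy) x⁻¹
  have h3 := hfrob _ h1 h2
  rw [Subgroup.mem_bot]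
  have : y = x * (x⁻¹ * y * x) * x⁻¹ := by group
  rw [this, h3]; group

theorem sh_main (n : ℕ) : ∀ (G : Type u) [Group G] [Finite G] (A : Subgroup G),
    Nat.card G = n → Group.IsSolvable A →
    (∀ H : Subgroup G, Group.IsSolvable H → A ≤ H → ∀ a ∈ A, ∀ x ∈ H, a * x = x * a) →
    ∀ a ∈ A, ∀ x, a * x = x * a := by
  induction n using Nat.strong_induction_on with
  | _ n ih =>
  intro G _ _ A hn hA h
  by_contra hcon
  refine sh_core A (Subgroup.centralizer (A : Set G)) ?_ ?_ ?_ ?_ ?_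
  · intro x
    rw [Subgroup.mem_centralizer_iff]; rfl
  · intro ht
    apply hcon
    intro a ha x
    have : x ∈ Subgroup.centralizer (A : Set G) := by rw [ht]; trivial
    exact Subgroup.mem_centralizer_iff.1 this a ha
  · intro x hx
    rw [Subgroup.mem_centralizer_iff]
    intro a ha
    exact h A hA le_rfl a ha x hx
  · intro H hAH hH x hx
    rw [Subgroup.mem_centralizer_iff]
    intro a ha
    have hlt : Nat.card H < n := by
      rw [← hn]
      refine lt_of_le_of_ne (Subgroup.card_le_card_group H) fun he => hH ?_
      exact Subgroup.eq_top_of_card_eq H he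
    have := ih _ hlt H (A.subgroupOf H) rfl
      (Group.isSolvable_of_surjective (f := (Subgroup.subgroupOfEquivOfLe hAH).symm.toMonoidHom)
        (Subgroup.subgroupOfEquivOfLe hAH).symm.surjective)
      (by
        intro S hS hAS a ha x hx
        have hS' : Group.IsSolvable (S.map H.subtype) :=
          Group.isSolvable_of_surjective (f := H.subtype.subgroupMap S)
            (MonoidHom.subgroupMap_surjective _ _)
        refine Subtype.ext (h (S.map H.subtype) hS' ?_ a ha x ⟨x, hx, rfl⟩)
        intro y hy
        exact ⟨⟨y, hAH hy⟩, hAS hy, rfl⟩)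
      ⟨a, hAH ha⟩ ha ⟨x, hx⟩
    exact congrArg Subtype.val this
  · intro N hN hNs
    by_contra hN1
    apply hcon
    have hlt : Nat.card (G ⧸ N) < n := by
      have h1 := N.index_mul_card
      have h2 : 1 < Nat.card N := (Subgroup.one_lt_card_iff_ne_bot N).2 hN1
      have h3 : 0 < Nat.card (G ⧸ N) := Nat.card_pos
      change Nat.card (G ⧸ N) * _ = _ at h1
      rw [← hn, ← h1]
      nlinarith
    have hAs : Group.IsSolvable (A.map (QuotientGroup.mk' N)) :=
      Group.isSolvable_of_surjective (f := (QuotientGroup.mk' N).subgroupMap A)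
        (MonoidHom.subgroupMap_surjective _ _)
    have hq := ih _ hlt (G ⧸ N) (A.map (QuotientGroup.mk' N)) rfl hAs (by
      rintro S hS hAS _ ⟨a, ha, rfl⟩ x hx
      obtain ⟨x, rfl⟩ := QuotientGroup.mk'_surjective N x
      rw [← map_mul, ← map_mul]
      congr 1
      refine h _ (sh_comap_solv N hNs S hS) ?_ a ha x hx
      exact fun y hy => hAS ⟨y, hy, rfl⟩)
    have hAn : (A.map (QuotientGroup.mk' N)).Normal := by
      constructor
      intro a ha g
      rw [← hq a ha g, mul_inv_cancel_right]
      exact ha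
    intro a ha g
    have hT : Group.IsSolvable (Subgroup.zpowers
      (QuotientGroup.mk' (A.map (QuotientGroup.mk' N)) (QuotientGroup.mk' N g))) := 
      Group.isSolvable_of_comm fun x y => mul_comm' x y
    refine h _ (sh_comap_solv N hNs _ (sh_comap_solv _ hAs _ hT)) ?_ a ha g ?_
    · intro y hy
      rw [Subgroup.mem_comap, Subgroup.mem_comap]
      have : QuotientGroup.mk' (A.map (QuotientGroup.mk' N)) (QuotientGroup.mk' N y) = 1 :=
        (QuotientGroup.eq_one_iff _).2 ⟨y, hy, rfl⟩
      rw [this]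
      exact Subgroup.one_mem _
    · exact Subgroup.mem_zpowers _

/-- Shult's theorem (Lemma 2.2): let `A` be a solvable subgroup of a finite group `G`
such that `A` lies in the center of every solvable subgroup of `G` containing `A`.
Then `A` lies in the center of `G`. -/
theorem stmt16 {G : Type*} [Group G] [Finite G] (A : Subgroup G) (hA : IsSolvable A)
    (h : ∀ H : Subgroup G, IsSolvable H → A ≤ H → ∀ a ∈ A, ∀ x ∈ H, a * x = x * a) :
    A ≤ Subgroup.center G := by
  intro a ha
  rw [Subgroup.mem_center_iff]
  intro g
  exact (sh_main _ G A rfl hA h a ha g).symm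
end
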